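/- Let 𝒻 be an intersecting family of circles in the elliptic-quadric Möbius plane of odd order q; that is, 𝒻 is a set of non-isotropic points of ℙ(F⁴) such that for all P, R ∈ 𝒻 there is an isotropic point S whose representatives s satisfy b(s,p) = 0 and b(s,r) = 0 for representatives p of P and r of R. If |𝒻| ≥ (1/√2)·q² + 2√2·q + 8 (as real numbers), then there exists an isotropic point S such that every P ∈ 𝒻 has representatives p with b(s,p) = 0 for representatives s of S. -/

import Mathlib

section MoebiusPlane

open Finset
open scoped LinearAlgebra.Projectivization

section Design

open scoped Classical in
/-- The `0`-`1` incidence function of a relation. -/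
noncomputable def incidence {α β : Type*} (I : α → β → Prop) (x : α) (c : β) : ℝ :=
  if I x c then 1 else 0

theorem incidence_mul_self {α β : Type*} (I : α → β → Prop) (x : α) (c : β) :
    incidence I x c * incidence I x c = incidence I x c := by
  unfold incidence; split_ifs <;> simp

theorem incidence_nonneg {α β : Type*} (I : α → β → Prop) (x : α) (c : β) : 0 ≤ incidence I x c := by
  unfold incidence; split_ifs <;> simp

open scoped Classical in
/-- A finite Möbius plane of order `q`, presented by its incidence counts. -/
structure IsMoebiusPlane {α β : Type*} [Fintype α] [Fintype β] (I : α → β → Prop) (q : ℕ) :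
    Prop where
  two_le : 2 ≤ q
  card_points : Fintype.card α = q ^ 2 + 1
  card_one : ∀ x, #{c | I x c} = q ^ 2 + q
  card_two : ∀ x y, x ≠ y → #{c | I x c ∧ I y c} = q + 1
  card_three : ∀ x y z, x ≠ y → y ≠ z → x ≠ z → #{c | I x c ∧ I y c ∧ I z c} = 1
  nonempty : ∀ c, ∃ x, I x c

namespace IsMoebiusPlane

variable {α β : Type*} [Fintype α] [Fintype β] {I : α → β → Prop} {q : ℕ}

open scoped Classical in
theorem sum_triple (h : IsMoebiusPlane I q) (x y z : α) :
    ∑ c, incidence I x c * incidence I y c * incidence I z c =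
      1 + q * ((if x = y then 1 else 0) + (if y = z then 1 else 0) + (if x = z then 1 else 0))
        + ((q : ℝ) ^ 2 - 2 * q - 1) * (if x = y then (if x = z then 1 else 0) else 0) := by
  have e : ∀ c, incidence I x c * incidence I y c * incidence I z c =
      if I x c ∧ I y c ∧ I z c then (1 : ℝ) else 0 := by
    intro c
    unfold incidence
    by_cases h1 : I x c <;> by_cases h2 : I y c <;> by_cases h3 : I z c <;> simp [h1, h2, h3]
  simp only [e, Finset.sum_boole]
  by_cases hxy : x = y
  · subst hxy
    by_cases hxz : x = z
    · subst hxz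
      simp only [and_self, h.card_one]
      push_cast
      simp
      ring
    · have := h.card_two x z hxz
      simp only [and_self_left, this, hxz]
      push_cast
      simp
      ring
  · by_cases hxz : x = z
    · subst hxz
      have := h.card_two x y hxy
      have e2 : ∀ c, (I x c ∧ I y c ∧ I x c) ↔ (I x c ∧ I y c) := fun c => by tauto
      simp only [e2, this, hxy, Ne.symm hxy]
      push_cast
      simp
      ring
    · by_cases hyz : y = z
      · subst hyz
        have := h.card_two x y hxy
        simp only [and_self, this, hxy]
        push_cast
        simp
        ring
      · rw [h.card_three x y z hxy hyz hxz]
        simp [hxy, hxz, hyz]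

open scoped Classical in
theorem sum_pair (h : IsMoebiusPlane I q) (x y : α) :
    ∑ c, incidence I x c * incidence I y c =
      q + 1 + ((q : ℝ) ^ 2 - 1) * (if x = y then 1 else 0) := by
  have := h.sum_triple x x y
  simp only [incidence_mul_self] at this
  rw [this]
  by_cases hxy : x = y <;> simp [hxy] <;> ring

theorem sum_single (h : IsMoebiusPlane I q) (x : α) :
    ∑ c, incidence I x c = (q : ℝ) ^ 2 + q := by
  have := h.sum_pair x x
  simp only [incidence_mul_self] at this
  rw [this]
  simp only [if_true]
  ring

/-- Sum of a point weight over the points of a circle. -/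
noncomputable def weight (I : α → β → Prop) (u : α → ℝ) (c : β) : ℝ :=
  ∑ x, u x * incidence I x c

theorem sum_weight (h : IsMoebiusPlane I q) (u : α → ℝ) :
    ∑ c, weight I u c = ((q : ℝ) ^ 2 + q) * ∑ x, u x := by
  unfold weight
  rw [Finset.sum_comm]
  simp only [← Finset.mul_sum, h.sum_single]
  rw [← Finset.sum_mul, mul_comm]

theorem sum_incidence_mul_weight (h : IsMoebiusPlane I q) (u : α → ℝ) (x : α) :
    ∑ c, incidence I x c * weight I u c = (q + 1) * ∑ y, u y + ((q : ℝ) ^ 2 - 1) * u x := by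
  classical
  unfold weight
  simp_rw [Finset.mul_sum]
  rw [Finset.sum_comm]
  have e : ∀ y c, incidence I x c * (u y * incidence I y c) =
      u y * (incidence I x c * incidence I y c) := fun y c => by ring
  simp only [e, ← Finset.mul_sum, h.sum_pair]
  simp only [mul_add, Finset.sum_add_distrib, mul_ite, mul_one, mul_zero, Finset.sum_ite_eq,
    Finset.mem_univ, if_true]
  rw [← Finset.sum_mul]
  ring

theorem sum_weight_sq (h : IsMoebiusPlane I q) (u : α → ℝ) :
    ∑ c, weight I u c ^ 2 =
      ((q : ℝ) ^ 2 - 1) * ∑ x, u x ^ 2 + (q + 1) * (∑ x, u x) ^ 2 := by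
  have e : ∀ c, weight I u c ^ 2 = ∑ x, u x * (incidence I x c * weight I u c) := by
    intro c
    rw [sq]
    nth_rewrite 1 [weight]
    rw [Finset.sum_mul]
    exact Finset.sum_congr rfl fun x _ => by ring
  simp only [e]
  rw [Finset.sum_comm]
  simp_rw [← Finset.mul_sum, h.sum_incidence_mul_weight]
  have e2 : ∀ x, u x * ((q + 1) * ∑ y, u y + ((q : ℝ) ^ 2 - 1) * u x) =
      u x * ((q + 1) * ∑ y, u y) + u x ^ 2 * ((q : ℝ) ^ 2 - 1) := fun x => by ring
  simp only [e2, Finset.sum_add_distrib, ← Finset.sum_mul]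
  ring

theorem sum_incidence_mul_weight_sq (h : IsMoebiusPlane I q) (u : α → ℝ) (x : α) :
    ∑ c, incidence I x c * weight I u c ^ 2 = (∑ y, u y) ^ 2
      + q * (2 * u x * ∑ y, u y + ∑ y, u y ^ 2) + ((q : ℝ) ^ 2 - 2 * q - 1) * u x ^ 2 := by
  classical
  have e : ∀ c, incidence I x c * weight I u c ^ 2 =
      ∑ y, ∑ z, u y * u z * (incidence I x c * incidence I y c * incidence I z c) := by
    intro c
    unfold weight
    rw [sq, Finset.sum_mul_sum, Finset.mul_sum]
    refine Finset.sum_congr rfl fun y _ => ?_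
    rw [Finset.mul_sum]
    exact Finset.sum_congr rfl fun z _ => by ring
  simp only [e]
  rw [Finset.sum_comm]
  simp_rw [Finset.sum_comm (s := (univ : Finset β)), ← Finset.mul_sum, h.sum_triple]
  simp only [mul_add, Finset.sum_add_distrib, mul_ite, mul_one, mul_zero, Finset.sum_ite_eq,
    Finset.mem_univ, if_true, Finset.sum_ite_irrel, Finset.sum_const_zero]
  simp only [← Finset.sum_mul, ← Finset.mul_sum]
  simp only [sq]
  ring

theorem sum_weight_cube (h : IsMoebiusPlane I q) (u : α → ℝ) :
    ∑ c, weight I u c ^ 3 = ((q : ℝ) ^ 2 - 2 * q - 1) * ∑ x, u x ^ 3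
      + 3 * q * (∑ x, u x) * (∑ x, u x ^ 2) + (∑ x, u x) ^ 3 := by
  have e : ∀ c, weight I u c ^ 3 = ∑ x, u x * (incidence I x c * weight I u c ^ 2) := by
    intro c
    rw [pow_succ']
    nth_rewrite 1 [weight]
    rw [Finset.sum_mul]
    exact Finset.sum_congr rfl fun x _ => by ring
  simp only [e]
  rw [Finset.sum_comm]
  simp_rw [← Finset.mul_sum, h.sum_incidence_mul_weight_sq]
  have e2 : ∀ x, u x * ((∑ y, u y) ^ 2 + q * (2 * u x * ∑ y, u y + ∑ y, u y ^ 2)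
      + ((q : ℝ) ^ 2 - 2 * q - 1) * u x ^ 2) =
      u x * ((∑ y, u y) ^ 2 + q * ∑ y, u y ^ 2) + u x ^ 2 * (2 * q * ∑ y, u y)
        + u x ^ 3 * ((q : ℝ) ^ 2 - 2 * q - 1) := fun x => by ring
  simp only [e2, Finset.sum_add_distrib, ← Finset.sum_mul]
  ring

end IsMoebiusPlane
end Design

namespace IsMoebiusPlane

variable {α β : Type*} {I : α → β → Prop} {q : ℕ}

/-- The number of circles of a family through a point. -/
noncomputable def degree (I : α → β → Prop) (𝒻 : Finset β) (x : α) : ℝ :=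
  ∑ c ∈ 𝒻, incidence I x c

theorem degree_nonneg (𝒻 : Finset β) (x : α) : 0 ≤ degree I 𝒻 x :=
  Finset.sum_nonneg fun c _ => incidence_nonneg I x c

variable [Fintype α]

/-- The number of common points of two circles. -/
noncomputable def meet (I : α → β → Prop) (c d : β) : ℝ := weight I (fun x => incidence I x c) d

open scoped Classical in
theorem meet_eq_card (c d : β) : meet I c d = (#{x | I x c ∧ I x d} : ℕ) := by
  have e : ∀ x, incidence I x c * incidence I x d = if I x c ∧ I x d then (1 : ℝ) else 0 := by
    intro x
    unfold incidence
    by_cases h1 : I x c <;> by_cases h2 : I x d <;> simp [h1, h2]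
  simp only [meet, weight, e, Finset.sum_boole]

theorem meet_ne_zero {c d : β} {x : α} (hc : I x c) (hd : I x d) : meet I c d ≠ 0 := by
  classical
  rw [meet_eq_card, Nat.cast_ne_zero, ← Nat.pos_iff_ne_zero, Finset.card_pos]
  exact ⟨x, by simp [hc, hd]⟩

theorem meet_comm (c d : β) : meet I c d = meet I d c := by
  simp only [meet, weight, mul_comm]

open scoped Classical in
/-- The `0`-`1` indicator of tangency of two circles. -/
noncomputable def tangency (I : α → β → Prop) (c d : β) : ℝ := if meet I c d = 1 then 1 else 0

theorem tangency_comm (c d : β) : tangency I c d = tangency I d c := by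
  simp only [tangency, meet_comm c d]

theorem tangency_nonneg (c d : β) : 0 ≤ tangency I c d := by
  unfold tangency; split_ifs <;> simp

theorem tangency_mul_self (c d : β) : tangency I c d * tangency I c d = tangency I c d := by
  unfold tangency; split_ifs <;> simp

theorem weight_degree (𝒻 : Finset β) (d : β) :
    weight I (degree I 𝒻) d = ∑ c ∈ 𝒻, meet I c d := by
  simp only [weight, degree, meet, Finset.sum_mul]
  rw [Finset.sum_comm]

theorem sum_degree_sq (𝒻 : Finset β) :
    ∑ x, degree I 𝒻 x ^ 2 = ∑ c ∈ 𝒻, ∑ d ∈ 𝒻, meet I c d := by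
  simp only [degree, meet, weight, sq, Finset.sum_mul_sum]
  rw [Finset.sum_comm]
  refine Finset.sum_congr rfl fun c _ => ?_
  rw [Finset.sum_comm]

variable [Fintype β]

theorem sum_one (h : IsMoebiusPlane I q) : ∑ _x : α, (1 : ℝ) = (q : ℝ) ^ 2 + 1 := by
  simp [h.card_points]

theorem sum_incidence_point (h : IsMoebiusPlane I q) (c : β) :
    ∑ x, incidence I x c = (q : ℝ) + 1 := by
  obtain ⟨x, hx⟩ := h.nonempty c
  have h0 : ∑ d, incidence I x d * (weight I (fun _ => 1) d - (q + 1)) ^ 2 = 0 := by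
    have e : ∀ d, incidence I x d * (weight I (fun _ => 1) d - (q + 1)) ^ 2 =
        incidence I x d * weight I (fun _ => 1) d ^ 2
          - 2 * (q + 1) * (incidence I x d * weight I (fun _ => 1) d)
          + (q + 1) ^ 2 * incidence I x d := fun d => by ring
    simp only [e, Finset.sum_add_distrib, Finset.sum_sub_distrib, ← Finset.mul_sum,
      h.sum_incidence_mul_weight, h.sum_incidence_mul_weight_sq, h.sum_single, one_pow, h.sum_one]
    ring
  have h1 := (Finset.sum_eq_zero_iff_of_nonneg
    (fun d _ => mul_nonneg (incidence_nonneg I x d) (sq_nonneg _))).1 h0 c (Finset.mem_univ c)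
  have hxc : incidence I x c = 1 := by simp [incidence, hx]
  rw [hxc, one_mul] at h1
  have h2 := pow_eq_zero_iff (two_ne_zero) |>.1 h1
  simp only [weight, one_mul] at h2
  linarith

theorem meet_self (h : IsMoebiusPlane I q) (c : β) : meet I c c = q + 1 := by
  simp only [meet, weight, incidence_mul_self, h.sum_incidence_point]

theorem sum_meet (h : IsMoebiusPlane I q) (c : β) :
    ∑ d, meet I c d = ((q : ℝ) ^ 2 + q) * (q + 1) := by
  simp only [meet, h.sum_weight, h.sum_incidence_point]

theorem sum_meet_sq (h : IsMoebiusPlane I q) (c : β) :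
    ∑ d, meet I c d ^ 2 = ((q : ℝ) ^ 2 - 1) * (q + 1) + (q + 1) * (q + 1) ^ 2 := by
  simp only [meet, h.sum_weight_sq, h.sum_incidence_point, sq (incidence I _ c), incidence_mul_self]

theorem sum_incidence_mul_meet (h : IsMoebiusPlane I q) {x : α} {c : β} (hx : ¬ I x c) :
    ∑ d, incidence I x d * meet I c d = ((q : ℝ) + 1) * (q + 1) := by
  simp only [meet, h.sum_incidence_mul_weight, h.sum_incidence_point]
  simp [incidence, hx]

theorem sum_incidence_mul_meet_sq (h : IsMoebiusPlane I q) {x : α} {c : β} (hx : ¬ I x c) :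
    ∑ d, incidence I x d * meet I c d ^ 2 = ((q : ℝ) + 1) ^ 2 + q * (q + 1) := by
  simp only [meet, h.sum_incidence_mul_weight_sq, h.sum_incidence_point, sq (incidence I _ c),
    incidence_mul_self]
  simp [incidence, hx]

open scoped Classical in
theorem card_common_le_two (h : IsMoebiusPlane I q) {c d : β} (hcd : c ≠ d) :
    #{x | I x c ∧ I x d} ≤ 2 := by
  by_contra! hlt
  obtain ⟨x, y, z, hx, hy, hz, hxy, hxz, hyz⟩ := Finset.two_lt_card_iff.1 hlt
  simp only [Finset.mem_filter, Finset.mem_univ, true_and] at hx hy hz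
  obtain ⟨e, he⟩ := Finset.card_eq_one.1 (h.card_three x y z hxy hyz hxz)
  have hc : c ∈ ({c | I x c ∧ I y c ∧ I z c} : Finset β) := by simp [hx.1, hy.1, hz.1]
  have hd : d ∈ ({c | I x c ∧ I y c ∧ I z c} : Finset β) := by simp [hx.2, hy.2, hz.2]
  rw [he, Finset.mem_singleton] at hc hd
  exact hcd (hc.trans hd.symm)

theorem meet_cases (h : IsMoebiusPlane I q) {c d : β} (hcd : c ≠ d) :
    meet I c d = 0 ∨ meet I c d = 1 ∨ meet I c d = 2 := by
  classical
  rw [meet_eq_card]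
  have := h.card_common_le_two hcd
  interval_cases #{x | I x c ∧ I x d} <;> simp

theorem tangency_self (h : IsMoebiusPlane I q) (c : β) : tangency I c c = 0 := by
  have := h.two_le
  simp only [tangency, h.meet_self]
  rw [if_neg]
  intro h'
  have : (q : ℝ) = 0 := by linarith
  norm_cast at this
  omega

open scoped Classical in
theorem tangency_eq (h : IsMoebiusPlane I q) (c d : β) :
    tangency I c d = meet I c d * (2 - meet I c d) + if c = d then (q : ℝ) ^ 2 - 1 else 0 := by
  by_cases hcd : c = d
  · subst hcd
    rw [h.tangency_self, h.meet_self, if_pos rfl]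
    ring
  · rw [if_neg hcd, tangency]
    rcases h.meet_cases hcd with e | e | e <;> rw [e] <;> norm_num

theorem sum_tangency (h : IsMoebiusPlane I q) (c : β) :
    ∑ d, tangency I c d = (q : ℝ) ^ 2 - 1 := by
  classical
  have e : ∀ d, meet I c d * (2 - meet I c d) = 2 * meet I c d - meet I c d ^ 2 :=
    fun d => by ring
  simp only [h.tangency_eq, Finset.sum_add_distrib, e, Finset.sum_sub_distrib, ← Finset.mul_sum,
    h.sum_meet, h.sum_meet_sq, Finset.sum_ite_eq, Finset.mem_univ, if_true]
  ring

theorem sum_incidence_mul_tangency (h : IsMoebiusPlane I q) {x : α} {c : β} (hx : ¬ I x c) :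
    ∑ d, incidence I x d * tangency I c d = (q : ℝ) + 1 := by
  classical
  have e : ∀ d, incidence I x d * tangency I c d =
      2 * (incidence I x d * meet I c d) - incidence I x d * meet I c d ^ 2 := by
    intro d
    rw [h.tangency_eq]
    by_cases hcd : c = d
    · subst hcd
      simp [incidence, hx]
    · rw [if_neg hcd]; ring
  simp only [e, Finset.sum_sub_distrib, ← Finset.mul_sum, h.sum_incidence_mul_meet hx,
    h.sum_incidence_mul_meet_sq hx]
  ring

open scoped Classical in
theorem card_through_le (h : IsMoebiusPlane I q) {x : α} {c : β} (hx : ¬ I x c)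
    (L : Finset β) (hL : ∀ d ∈ L, I x d ∧ meet I c d ≠ 0) :
    (#L : ℝ) ≤ (q + 1) * (q + 2) / 2 := by
  have e : ∀ d, (if d ∈ L then (1 : ℝ) else 0) ≤
      (3 * (incidence I x d * meet I c d) - incidence I x d * meet I c d ^ 2) / 2 := by
    intro d
    by_cases hd : I x d
    · have hcd : c ≠ d := by rintro rfl; exact hx hd
      simp only [incidence, hd, if_true]
      by_cases hdL : d ∈ L
      · rcases h.meet_cases hcd with e | e | e
        · exact absurd e (hL d hdL).2
        · rw [e, if_pos hdL]; norm_num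
        · rw [e, if_pos hdL]; norm_num
      · rcases h.meet_cases hcd with e | e | e <;> rw [e, if_neg hdL] <;> norm_num
    · have : d ∉ L := fun h' => hd (hL d h').1
      simp [incidence, hd, this]
  calc (#L : ℝ) = ∑ d, if d ∈ L then (1 : ℝ) else 0 := by simp
    _ ≤ ∑ d, (3 * (incidence I x d * meet I c d) - incidence I x d * meet I c d ^ 2) / 2 :=
      Finset.sum_le_sum fun d _ => e d
    _ = (q + 1) * (q + 2) / 2 := by
      rw [← Finset.sum_div, Finset.sum_sub_distrib, ← Finset.mul_sum,
        h.sum_incidence_mul_meet hx, h.sum_incidence_mul_meet_sq hx]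
      ring

theorem sum_circles_one (h : IsMoebiusPlane I q) : ∑ _c : β, (1 : ℝ) = (q : ℝ) ^ 3 + q := by
  have e1 : ∑ c : β, ∑ x, incidence I x c = (∑ _c : β, (1 : ℝ)) * (q + 1) := by
    simp only [h.sum_incidence_point]
    rw [Finset.sum_mul]; simp
  rw [Finset.sum_comm] at e1
  simp only [h.sum_single, Finset.sum_const, Finset.card_univ, h.card_points, nsmul_eq_mul] at e1
  have hq : (q : ℝ) + 1 ≠ 0 := by positivity
  simp only [Finset.sum_const, Finset.card_univ, nsmul_eq_mul]
  apply mul_right_cancel₀ hq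
  rw [← e1]; push_cast; ring

end IsMoebiusPlane

section SameClass

variable {β : Type*}

open scoped Classical in
/-- The `0`-`1` indicator of two circles lying in the same class. -/
noncomputable def sameClass (cls : β → Prop) (c d : β) : ℝ := if (cls c ↔ cls d) then 1 else 0

theorem sameClass_comm (cls : β → Prop) (c d : β) : sameClass cls c d = sameClass cls d c := by
  by_cases h1 : cls c <;> by_cases h2 : cls d <;> simp [sameClass, h1, h2]

theorem sameClass_self (cls : β → Prop) (c : β) : sameClass cls c c = 1 := by
  simp [sameClass]

theorem sameClass_nonneg (cls : β → Prop) (c d : β) : 0 ≤ sameClass cls c d := by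
  unfold sameClass; split_ifs <;> simp

theorem sameClass_le_one (cls : β → Prop) (c d : β) : sameClass cls c d ≤ 1 := by
  unfold sameClass; split_ifs <;> simp

theorem sameClass_eq_of_ne_zero {cls : β → Prop} {c d : β} (hcd : sameClass cls c d ≠ 0) (e : β) :
    sameClass cls c e = sameClass cls d e := by
  by_cases h1 : cls c <;> by_cases h2 : cls d <;> by_cases h3 : cls e <;> simp_all [sameClass]

end SameClass

open scoped Classical in
/-- A finite Möbius plane of order `q` together with a tangency-invariant partition `cls` of its
circles into classes, each covering at most half of the circles through any two points, in which
two circles with a common point have at most `2 * (q - 1)` common tangent circles. -/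
structure IsClassedMoebiusPlane {α β : Type*} [Fintype α] [Fintype β] (I : α → β → Prop) (q : ℕ)
    (cls : β → Prop) : Prop extends IsMoebiusPlane I q where
  class_eq : ∀ c d, #{x | I x c ∧ I x d} = 1 → (cls c ↔ cls d)
  class_two : ∀ x y, x ≠ y → ∀ c, 2 * #{d | I x d ∧ I y d ∧ (cls c ↔ cls d)} ≤ q + 1
  common_tangents : ∀ x c d, c ≠ d → I x c → I x d →
    #{e | #{x | I x c ∧ I x e} = 1 ∧ #{x | I x d ∧ I x e} = 1} ≤ 2 * (q - 1)

namespace IsClassedMoebiusPlane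

open IsMoebiusPlane

variable {α β : Type*} [Fintype α] [Fintype β] {I : α → β → Prop} {q : ℕ} {cls : β → Prop}

theorem sum_sameClass_le (h : IsClassedMoebiusPlane I q cls) (c : β) :
    ∑ d, sameClass cls c d ≤ (q : ℝ) * (q ^ 2 + 1) / 2 := by
  classical
  have hpair : ∀ x y : α, ∑ d, sameClass cls c d * (incidence I x d * incidence I y d) =
      (#{d | I x d ∧ I y d ∧ (cls c ↔ cls d)} : ℕ) := by
    intro x y
    rw [← Finset.sum_boole]
    refine Finset.sum_congr rfl fun d _ => ?_
    unfold sameClass incidence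
    by_cases h1 : I x d <;> by_cases h2 : I y d <;> by_cases h3 : (cls c ↔ cls d) <;>
      simp [h1, h2, h3]
  have key : ∀ d, ∑ x, ∑ y, (if x = y then 0 else incidence I x d * incidence I y d) =
      ((q : ℝ) + 1) * q := by
    intro d
    have e : ∀ x y, (if x = y then 0 else incidence I x d * incidence I y d) =
        incidence I x d * incidence I y d - if x = y then incidence I x d else 0 := by
      intro x y
      split_ifs with hxy
      · rw [← hxy, incidence_mul_self, sub_self]
      · rw [sub_zero]
    simp only [e, Finset.sum_sub_distrib, ← Finset.mul_sum, h.sum_incidence_point,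
      Finset.sum_ite_eq, Finset.mem_univ, if_true, ← Finset.sum_mul]
    ring
  have e1 : (∑ d, sameClass cls c d) * (((q : ℝ) + 1) * q) =
      ∑ x, ∑ y, (if x = y then 0 else
        ∑ d, sameClass cls c d * (incidence I x d * incidence I y d)) := by
    calc (∑ d, sameClass cls c d) * (((q : ℝ) + 1) * q)
        = ∑ d, sameClass cls c d *
          ∑ x, ∑ y, (if x = y then 0 else incidence I x d * incidence I y d) := by
          simp only [key, Finset.sum_mul]
      _ = ∑ d, ∑ x, ∑ y, (if x = y then 0 else
            sameClass cls c d * (incidence I x d * incidence I y d)) := by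
          simp only [Finset.mul_sum, mul_ite, mul_zero]
      _ = _ := by
          rw [Finset.sum_comm]
          refine Finset.sum_congr rfl fun x _ => ?_
          rw [Finset.sum_comm]
          refine Finset.sum_congr rfl fun y _ => ?_
          split_ifs <;> simp
  have e2 : ∑ x : α, ∑ y : α, (if x = y then 0 else
        ∑ d, sameClass cls c d * (incidence I x d * incidence I y d)) ≤
      ∑ x : α, ∑ y : α, ((q + 1) / 2 - if x = y then ((q : ℝ) + 1) / 2 else 0) := by
    refine Finset.sum_le_sum fun x _ => Finset.sum_le_sum fun y _ => ?_
    split_ifs with hxy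
    · simp
    · rw [hpair, sub_zero]
      have := h.class_two x y hxy c
      have h' : (2 : ℝ) * (#{d | I x d ∧ I y d ∧ (cls c ↔ cls d)} : ℕ) ≤ q + 1 := by
        exact_mod_cast this
      linarith
  have e3 : ∑ x : α, ∑ y : α, ((q + 1) / 2 - if x = y then ((q : ℝ) + 1) / 2 else 0) =
      ((q : ℝ) ^ 2 + 1) * q ^ 2 * ((q + 1) / 2) := by
    simp only [Finset.sum_sub_distrib, Finset.sum_ite_eq, Finset.mem_univ, if_true,
      Finset.sum_const, Finset.card_univ, h.card_points, nsmul_eq_mul]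
    push_cast; ring
  have hq : 0 < (q : ℝ) := by
    have := h.two_le
    exact_mod_cast (by omega : 0 < q)
  rw [e3, ← e1] at e2
  have hp : 0 < ((q : ℝ) + 1) * q := by positivity
  refine le_of_mul_le_mul_right (e2.trans_eq ?_) hp
  ring

theorem tangency_eq_mul (h : IsClassedMoebiusPlane I q cls) (c d : β) :
    tangency I c d = sameClass cls c d * tangency I c d := by
  classical
  unfold tangency
  split_ifs with hm
  · rw [meet_eq_card, Nat.cast_eq_one] at hm
    simp [sameClass, h.class_eq c d hm]
  · simp

theorem sum_tangency_mul_tangency_le (h : IsClassedMoebiusPlane I q cls) {x : α} {c d : β}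
    (hcd : c ≠ d) (hc : I x c) (hd : I x d) :
    ∑ e, tangency I c e * tangency I d e ≤ 2 * ((q : ℝ) - 1) * sameClass cls c d := by
  classical
  by_cases hs : cls c ↔ cls d
  · have e1 : ∑ e, tangency I c e * tangency I d e =
        (#{e | #{x | I x c ∧ I x e} = 1 ∧ #{x | I x d ∧ I x e} = 1} : ℕ) := by
      rw [← Finset.sum_boole]
      refine Finset.sum_congr rfl fun e _ => ?_
      simp only [tangency, meet_eq_card, Nat.cast_eq_one]
      by_cases h1 : #{x | I x c ∧ I x e} = 1 <;> by_cases h2 : #{x | I x d ∧ I x e} = 1 <;>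
        simp [h1, h2]
    have h2 := h.common_tangents x c d hcd hc hd
    have hq := h.two_le
    rw [e1, sameClass, if_pos hs, mul_one]
    have : ((#{e | #{x | I x c ∧ I x e} = 1 ∧ #{x | I x d ∧ I x e} = 1} : ℕ) : ℝ) ≤
        ((2 * (q - 1) : ℕ) : ℝ) := by exact_mod_cast h2
    rw [Nat.cast_mul, Nat.cast_sub (by omega)] at this
    exact_mod_cast this
  · rw [sameClass, if_neg hs, mul_zero]
    refine (Finset.sum_eq_zero fun e _ => ?_).le
    rw [h.tangency_eq_mul c e, h.tangency_eq_mul d e]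
    by_cases h1 : cls c ↔ cls e
    · have h2 : ¬ (cls d ↔ cls e) := fun h2 => hs (h1.trans h2.symm)
      simp [sameClass, h2]
    · simp [sameClass, h1]

/-- In an intersecting family the number of ordered tangent pairs is bounded. -/
theorem sum_tangency_family_le (h : IsClassedMoebiusPlane I q cls) (𝒻 : Finset β)
    (hint : ∀ c ∈ 𝒻, ∀ d ∈ 𝒻, ∃ x, I x c ∧ I x d) :
    ((q : ℝ) ^ 2 + 1) * ∑ c ∈ 𝒻, ∑ d ∈ 𝒻, tangency I c d ≤
      ((q : ℝ) ^ 2 + 1) * (q - 1) * #𝒻 + (q + 1) * (#𝒻 : ℝ) ^ 2 := by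
  classical
  set χ : β → ℝ := fun d => if d ∈ 𝒻 then 1 else 0 with hχ
  set t : β → ℝ := fun d => ∑ c ∈ 𝒻, tangency I c d with ht
  set g : β → ℝ := fun d => ∑ c ∈ 𝒻, sameClass cls c d with hg
  set T := ∑ c ∈ 𝒻, ∑ d ∈ 𝒻, tangency I c d with hT
  set Φ := ∑ c ∈ 𝒻, g c with hΦ
  have hq : (2 : ℝ) ≤ q := by exact_mod_cast h.two_le
  have s1 : ∑ d, t d ^ 2 ≤ ((q : ℝ) ^ 2 - 1) * #𝒻 + 2 * (q - 1) * (Φ - #𝒻) := by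
    have e : ∑ d, t d ^ 2 = ∑ c ∈ 𝒻, ∑ c' ∈ 𝒻, ∑ d, tangency I c d * tangency I c' d := by
      simp only [ht, sq, Finset.sum_mul_sum]
      rw [Finset.sum_comm]
      refine Finset.sum_congr rfl fun c _ => ?_
      rw [Finset.sum_comm]
    rw [e]
    calc ∑ c ∈ 𝒻, ∑ c' ∈ 𝒻, ∑ d, tangency I c d * tangency I c' d
        ≤ ∑ c ∈ 𝒻, ∑ c' ∈ 𝒻, (2 * ((q : ℝ) - 1) * sameClass cls c' c +
          if c = c' then ((q : ℝ) ^ 2 - 1) - 2 * (q - 1) else 0) := by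
          refine Finset.sum_le_sum fun c hc => Finset.sum_le_sum fun c' hc' => ?_
          split_ifs with hcc
          · subst hcc
            simp only [tangency_mul_self, h.sum_tangency, sameClass_self]
            linarith
          · obtain ⟨x, hx, hx'⟩ := hint c hc c' hc'
            rw [add_zero, sameClass_comm]
            exact h.sum_tangency_mul_tangency_le hcc hx hx'
      _ = _ := by
          simp only [Finset.sum_add_distrib, ← Finset.mul_sum, Finset.sum_ite_eq]
          rw [Finset.sum_ite_of_true (fun c hc => hc)]
          simp only [Finset.sum_const, nsmul_eq_mul, hΦ, hg]
          ring
  have hmem : ∀ u : β → ℝ, ∑ d, u d * χ d = ∑ d ∈ 𝒻, u d := by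
    intro u
    simp [hχ]
  have s2 : ∑ d, t d * χ d = T := by
    rw [hmem, hT, Finset.sum_comm]
  have s3 : ∑ d, χ d ^ 2 = #𝒻 := by simp [hχ]
  have s4 : ∑ d, t d * g d = ((q : ℝ) ^ 2 - 1) * Φ := by
    have e : ∀ d, t d * g d = ∑ c ∈ 𝒻, tangency I c d * g c := by
      intro d
      rw [ht, Finset.sum_mul]
      refine Finset.sum_congr rfl fun c _ => ?_
      rw [h.tangency_eq_mul c d]
      by_cases hs : sameClass cls c d = 0
      · simp [hs]
      · have : g d = g c := by
          refine Finset.sum_congr rfl fun e _ => ?_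
          rw [sameClass_comm _ e d, sameClass_comm _ e c, sameClass_eq_of_ne_zero hs]
        rw [this]
    simp only [e]
    rw [Finset.sum_comm]
    simp only [← Finset.sum_mul, h.sum_tangency]
    rw [hΦ, Finset.mul_sum]
  have s5 : ∑ d, g d * χ d = Φ := hmem g
  have hg0 : ∀ d, 0 ≤ g d := fun d => Finset.sum_nonneg fun c _ => sameClass_nonneg cls c d
  have s6 : ∑ d, g d ^ 2 ≤ (q : ℝ) * (q ^ 2 + 1) / 2 * Φ := by
    have e : ∀ d, g d ^ 2 = ∑ c ∈ 𝒻, sameClass cls c d * g c := by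
      intro d
      rw [sq]
      nth_rewrite 1 [hg]
      rw [Finset.sum_mul]
      refine Finset.sum_congr rfl fun c _ => ?_
      by_cases hs : sameClass cls c d = 0
      · simp [hs]
      · have : g d = g c := by
          refine Finset.sum_congr rfl fun e _ => ?_
          rw [sameClass_comm _ e d, sameClass_comm _ e c, sameClass_eq_of_ne_zero hs]
        rw [this]
    simp only [e]
    rw [Finset.sum_comm]
    simp only [← Finset.sum_mul]
    rw [hΦ, Finset.mul_sum]
    exact Finset.sum_le_sum fun c _ => mul_le_mul_of_nonneg_right (h.sum_sameClass_le c) (hg0 c)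
  have s7 : Φ ≤ (#𝒻 : ℝ) ^ 2 := by
    calc Φ ≤ ∑ c ∈ 𝒻, ∑ d ∈ 𝒻, (1 : ℝ) :=
          Finset.sum_le_sum fun c _ => Finset.sum_le_sum fun d _ => sameClass_le_one cls d c
      _ = _ := by simp [sq]
  set n : ℝ := (q : ℝ) ^ 2 + 1 with hn
  have hn0 : 0 < n := by positivity
  have s8 : 0 ≤ ∑ d, (n * (t d - (q - 1) * χ d) - 2 * (q - 1) * g d) ^ 2 :=
    Finset.sum_nonneg fun d _ => sq_nonneg _
  have e8 : ∑ d, (n * (t d - (q - 1) * χ d) - 2 * (q - 1) * g d) ^ 2 =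
      n ^ 2 * ∑ d, t d ^ 2 + n ^ 2 * (q - 1) ^ 2 * ∑ d, χ d ^ 2
        + 4 * (q - 1) ^ 2 * ∑ d, g d ^ 2 - 2 * n ^ 2 * (q - 1) * ∑ d, t d * χ d
        - 4 * n * (q - 1) * ∑ d, t d * g d + 4 * n * (q - 1) ^ 2 * ∑ d, g d * χ d := by
    simp only [Finset.mul_sum, ← Finset.sum_add_distrib, ← Finset.sum_sub_distrib]
    exact Finset.sum_congr rfl fun d _ => by ring
  rw [e8, s2, s3, s4, s5] at s8
  have b1 := mul_le_mul_of_nonneg_left s1 (sq_nonneg n)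
  have b2 := mul_le_mul_of_nonneg_left s6 (by positivity : (0 : ℝ) ≤ 4 * (q - 1) ^ 2)
  have b3 : 0 ≤ (2 * n * (q - 1)) * (n * (q - 1) * #𝒻 + (q + 1) * Φ - n * T) := by
    have : (q : ℝ) ^ 2 = n - 1 := by rw [hn]; ring
    rw [this] at *
    nlinarith [s8, b1, b2]
  have b4 : 0 ≤ n * (q - 1) * #𝒻 + (q + 1) * Φ - n * T :=
    nonneg_of_mul_nonneg_right b3 (by
      have : (0 : ℝ) < q - 1 := by linarith
      positivity)
  have b5 := mul_le_mul_of_nonneg_left s7 (by linarith : (0 : ℝ) ≤ q + 1)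
  linarith

end IsClassedMoebiusPlane

theorem degree_polynomial_bound {q f : ℝ} (hq : 9 ≤ q)
    (hf : 707 / 1000 * q ^ 2 + 2828 / 1000 * q + 8 ≤ f) :
    7 / 2 * q * (q ^ 2 - 2 * q - 1) * (q ^ 2 + 1) ^ 2 ≤
      f * (f * (2 * q ^ 2 - q + 1) * (q ^ 2 - 3 * q) - (q ^ 2 + 1) ^ 2 * q * (q + 1)) := by
  obtain ⟨t, ht⟩ : ∃ t, t = q - 9 := ⟨_, rfl⟩
  obtain rfl : q = 9 + t := by linarith
  have ht0 : 0 ≤ t := by linarith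
  set φ : ℝ := 707 / 1000 * (9 + t) ^ 2 + 2828 / 1000 * (9 + t) + 8 with hφ
  set A : ℝ := (2 * (9 + t) ^ 2 - (9 + t) + 1) * ((9 + t) ^ 2 - 3 * (9 + t)) with hA
  set B : ℝ := ((9 + t) ^ 2 + 1) ^ 2 * (9 + t) * ((9 + t) + 1) with hB
  have hA0 : 0 ≤ A := by
    have : A = (2 * t ^ 2 + 35 * t + 154) * (t ^ 2 + 15 * t + 54) := by rw [hA]; ring
    rw [this]; positivity
  have hφ0 : 0 < φ := by positivity
  have key : 0 ≤ φ * (φ * A - B)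
      - 7 / 2 * (9 + t) * ((9 + t) ^ 2 - 2 * (9 + t) - 1) * ((9 + t) ^ 2 + 1) ^ 2 := by
    rw [hφ, hA, hB]
    ring_nf
    positivity
  have hpos : 0 ≤ 7 / 2 * (9 + t) * ((9 + t) ^ 2 - 2 * (9 + t) - 1) * ((9 + t) ^ 2 + 1) ^ 2 := by
    have : (9 + t) ^ 2 - 2 * (9 + t) - 1 = t ^ 2 + 16 * t + 62 := by ring
    rw [this]; positivity
  have h1 : 0 ≤ φ * A - B := nonneg_of_mul_nonneg_right (by linarith) hφ0
  have h2 : φ * A - B ≤ f * A - B := by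
    have := mul_le_mul_of_nonneg_right hf hA0
    linarith
  have h3 : φ * (φ * A - B) ≤ f * (f * A - B) := mul_le_mul hf h2 h1 (by linarith)
  have h4 : f * (f * A - B) = f * (f * (2 * (9 + t) ^ 2 - (9 + t) + 1) *
      ((9 + t) ^ 2 - 3 * (9 + t)) - ((9 + t) ^ 2 + 1) ^ 2 * (9 + t) * ((9 + t) + 1)) := by
    rw [hA, hB]; ring
  linarith

theorem stability_polynomial_bound {q f m : ℝ} (hq : 9 ≤ q)
    (hf : 707 / 1000 * q ^ 2 + 2828 / 1000 * q + 8 ≤ f) (hm : 7 / 2 * q ≤ m)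
    (hm' : m ≤ (q + 1) * (q + 2) / 2) :
    m * ((q - 1) * (q ^ 2 - q - 1 + m)) < (f - m) * (m - q - 1) ^ 2 := by
  obtain ⟨t, ht⟩ : ∃ t, t = q - 9 := ⟨_, rfl⟩
  obtain rfl : q = 9 + t := by linarith
  have ht0 : 0 ≤ t := by linarith
  set φ : ℝ := 707 / 1000 * (9 + t) ^ 2 + 2828 / 1000 * (9 + t) + 8 with hφ
  set a : ℝ := 7 / 2 * (9 + t) with ha
  set b : ℝ := (9 + t + 1) * (9 + t + 2) / 2 with hb
  set g₀ : ℝ := φ * (9 + t + 1) ^ 2 with hg₀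
  set g₁ : ℝ := -2 * φ * (9 + t + 1) - (9 + t + 1) ^ 2
    - (9 + t - 1) * ((9 + t) ^ 2 - (9 + t) - 1) with hg₁
  set g₂ : ℝ := φ + (9 + t) + 3 with hg₂
  have hG : ∀ x : ℝ, (φ - x) * (x - (9 + t) - 1) ^ 2
      - x * ((9 + t - 1) * ((9 + t) ^ 2 - (9 + t) - 1 + x)) =
      g₀ + g₁ * x + g₂ * x ^ 2 - x ^ 3 := fun x => by rw [hg₀, hg₁, hg₂]; ring
  have c₀ : 0 < g₀ + g₁ * a + g₂ * a ^ 2 - a ^ 3 := by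
    rw [hg₀, hg₁, hg₂, hφ, ha]; ring_nf; positivity
  have c₁ : 0 < 3 * (g₀ + g₁ * a + g₂ * a ^ 2 - a ^ 3)
      + (g₁ + 2 * g₂ * a - 3 * a ^ 2) * (b - a) := by
    rw [hg₀, hg₁, hg₂, hφ, ha, hb]; ring_nf; positivity
  have c₂ : 0 < 3 * (g₀ + g₁ * b + g₂ * b ^ 2 - b ^ 3)
      - (g₁ + 2 * g₂ * b - 3 * b ^ 2) * (b - a) := by
    rw [hg₀, hg₁, hg₂, hφ, ha, hb]; ring_nf; positivity
  have c₃ : 0 < g₀ + g₁ * b + g₂ * b ^ 2 - b ^ 3 := by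
    rw [hg₀, hg₁, hg₂, hφ, hb]; ring_nf; positivity
  have hba : 0 < b - a := by rw [hb, ha]; ring_nf; positivity
  clear_value φ a b g₀ g₁ g₂
  have hbm : 0 ≤ b - m := by linarith
  have hma : 0 ≤ m - a := by linarith
  have bern : (b - a) ^ 3 * (g₀ + g₁ * m + g₂ * m ^ 2 - m ^ 3) =
      (b - m) ^ 3 * (g₀ + g₁ * a + g₂ * a ^ 2 - a ^ 3)
      + (b - m) ^ 2 * (m - a) * (3 * (g₀ + g₁ * a + g₂ * a ^ 2 - a ^ 3)
        + (g₁ + 2 * g₂ * a - 3 * a ^ 2) * (b - a))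
      + (b - m) * (m - a) ^ 2 * (3 * (g₀ + g₁ * b + g₂ * b ^ 2 - b ^ 3)
        - (g₁ + 2 * g₂ * b - 3 * b ^ 2) * (b - a))
      + (m - a) ^ 3 * (g₀ + g₁ * b + g₂ * b ^ 2 - b ^ 3) := by ring
  have hpos : 0 < (b - a) ^ 3 * (g₀ + g₁ * m + g₂ * m ^ 2 - m ^ 3) := by
    rw [bern]
    rcases hbm.eq_or_lt with e | e
    · have hm0 : 0 < m - a := by linarith
      positivity
    · positivity
  have h1 : 0 < g₀ + g₁ * m + g₂ * m ^ 2 - m ^ 3 :=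
    pos_of_mul_pos_right hpos (by positivity)
  rw [← hG] at h1
  have h2 := mul_le_mul_of_nonneg_right (sub_le_sub_right hf m) (sq_nonneg (m - (9 + t) - 1))
  linarith

namespace IsMoebiusPlane

variable {α β : Type*} [Fintype α] [Fintype β] {I : α → β → Prop} {q : ℕ}

open scoped Classical in
theorem meet_eq_of_ne_zero (h : IsMoebiusPlane I q) {c d : β} (hcd : meet I c d ≠ 0) :
    meet I c d = 2 - tangency I c d + if c = d then (q : ℝ) - 1 else 0 := by
  by_cases e : c = d
  · subst e
    rw [h.tangency_self, h.meet_self, if_pos rfl]; ring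
  · rw [if_neg e, tangency]
    rcases h.meet_cases e with e | e | e <;> (simp_all; try norm_num)

theorem sum_meet_family (h : IsMoebiusPlane I q) (𝒻 : Finset β)
    (hint : ∀ c ∈ 𝒻, ∀ d ∈ 𝒻, ∃ x, I x c ∧ I x d) :
    ∑ c ∈ 𝒻, ∑ d ∈ 𝒻, meet I c d =
      2 * (#𝒻 : ℝ) ^ 2 + (q - 1) * #𝒻 - ∑ c ∈ 𝒻, ∑ d ∈ 𝒻, tangency I c d := by
  classical
  have e : ∑ c ∈ 𝒻, ∑ d ∈ 𝒻, meet I c d = ∑ c ∈ 𝒻, ∑ d ∈ 𝒻,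
      (2 - tangency I c d + if c = d then (q : ℝ) - 1 else 0) := by
    refine Finset.sum_congr rfl fun c hc => Finset.sum_congr rfl fun d hd => ?_
    obtain ⟨x, hx, hx'⟩ := hint c hc d hd
    exact h.meet_eq_of_ne_zero (meet_ne_zero hx hx')
  rw [e]
  simp only [Finset.sum_add_distrib, Finset.sum_sub_distrib, Finset.sum_ite_eq]
  rw [Finset.sum_ite_of_true (fun c hc => hc)]
  simp only [Finset.sum_const, nsmul_eq_mul]
  ring

theorem sum_degree (h : IsMoebiusPlane I q) (𝒻 : Finset β) :
    ∑ x, degree I 𝒻 x = (q + 1) * #𝒻 := by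
  simp only [degree]
  rw [Finset.sum_comm]
  simp only [h.sum_incidence_point, Finset.sum_const, nsmul_eq_mul]
  ring

theorem third_moment_bound (h : IsMoebiusPlane I q) (𝒻 : Finset β) {a : ℝ}
    (ha : ((q : ℝ) + 1) ^ 2 * #𝒻 / (q ^ 2 + 1) ≤ a)
    (hsum : ∑ x, degree I 𝒻 x ^ 2 = #𝒻 * a) :
    #𝒻 * a * (a - ((q : ℝ) + 1) ^ 2 * #𝒻 / (q ^ 2 + 1)) ^ 2 ≤
      ((q : ℝ) ^ 2 - 2 * q - 1) * ∑ x, degree I 𝒻 x ^ 3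
        + 3 * q * ((q + 1) * #𝒻) * (#𝒻 * a) + ((q + 1) * #𝒻) ^ 3
        - 2 * (((q : ℝ) + 1) ^ 2 * #𝒻 / (q ^ 2 + 1)) *
          (((q : ℝ) ^ 2 - 1) * (#𝒻 * a) + (q + 1) * ((q + 1) * #𝒻) ^ 2)
        + (((q : ℝ) + 1) ^ 2 * #𝒻 / (q ^ 2 + 1)) ^ 2 * (((q : ℝ) ^ 2 + q) * ((q + 1) * #𝒻)) := by
  set r : ℝ := ((q : ℝ) + 1) ^ 2 * #𝒻 / (q ^ 2 + 1) with hr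
  set w : β → ℝ := weight I (degree I 𝒻) with hw
  have hw0 : ∀ d, 0 ≤ w d := fun d =>
    Finset.sum_nonneg fun x _ => mul_nonneg (degree_nonneg 𝒻 x) (incidence_nonneg I x d)
  have hw1 : ∑ d ∈ 𝒻, w d = #𝒻 * a := by
    rw [← hsum, sum_degree_sq, Finset.sum_comm]
    exact Finset.sum_congr rfl fun d _ => weight_degree 𝒻 d
  have s1 : ∑ d ∈ 𝒻, w d * (w d - r) ^ 2 ≤ ∑ d, w d * (w d - r) ^ 2 :=
    Finset.sum_le_univ_sum_of_nonneg fun d => mul_nonneg (hw0 d) (sq_nonneg _)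
  have s2 : ∑ d, w d * (w d - r) ^ 2 =
      ∑ d, w d ^ 3 - 2 * r * ∑ d, w d ^ 2 + r ^ 2 * ∑ d, w d := by
    simp only [Finset.mul_sum, ← Finset.sum_add_distrib, ← Finset.sum_sub_distrib]
    exact Finset.sum_congr rfl fun d _ => by ring
  rw [hw, h.sum_weight_cube, h.sum_weight_sq, h.sum_weight, hsum, h.sum_degree, ← hw] at s2
  have hr0 : 0 ≤ r := by positivity
  have s3 : ∑ d ∈ 𝒻, (a * (a - r) ^ 2 + (w d - a) * ((a - r) ^ 2 + 2 * a * (a - r))) ≤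
      ∑ d ∈ 𝒻, w d * (w d - r) ^ 2 := by
    refine Finset.sum_le_sum fun d _ => ?_
    have : 0 ≤ (w d - a) ^ 2 * (w d + 2 * (a - r)) :=
      mul_nonneg (sq_nonneg _) (by linarith [hw0 d])
    nlinarith
  have s4 : ∑ d ∈ 𝒻, (a * (a - r) ^ 2 + (w d - a) * ((a - r) ^ 2 + 2 * a * (a - r))) =
      #𝒻 * a * (a - r) ^ 2 := by
    rw [Finset.sum_add_distrib, ← Finset.sum_mul, ← Finset.sum_mul, Finset.sum_sub_distrib, hw1]
    simp only [Finset.sum_const, nsmul_eq_mul]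
    ring
  linarith

theorem max_degree_moment_bound (h : IsMoebiusPlane I q) (𝒻 : Finset β) {M a : ℝ}
    (hM : ∀ x, degree I 𝒻 x ≤ M) (hsum : ∑ x, degree I 𝒻 x ^ 2 = #𝒻 * a) (b : ℝ) :
    ∑ x, degree I 𝒻 x ^ 3 ≤ (M + 2 * b) * (#𝒻 * a) - (2 * b * M + b ^ 2) * ((q + 1) * #𝒻)
      + b ^ 2 * M * (q ^ 2 + 1) := by
  have s1 : 0 ≤ ∑ x, (M - degree I 𝒻 x) * (degree I 𝒻 x - b) ^ 2 :=
    Finset.sum_nonneg fun x _ => mul_nonneg (by linarith [hM x]) (sq_nonneg _)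
  have s2 : ∑ x, (M - degree I 𝒻 x) * (degree I 𝒻 x - b) ^ 2 =
      (M + 2 * b) * ∑ x, degree I 𝒻 x ^ 2 - (2 * b * M + b ^ 2) * ∑ x, degree I 𝒻 x
        + b ^ 2 * M * ∑ _x : α, (1 : ℝ) - ∑ x, degree I 𝒻 x ^ 3 := by
    simp only [Finset.mul_sum, ← Finset.sum_add_distrib, ← Finset.sum_sub_distrib]
    exact Finset.sum_congr rfl fun d _ => by ring
  rw [hsum, h.sum_degree, h.sum_one] at s2
  linarith

end IsMoebiusPlane

namespace IsClassedMoebiusPlane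

open IsMoebiusPlane

variable {α β : Type*} [Fintype α] [Fintype β] {I : α → β → Prop} {q : ℕ} {cls : β → Prop}

theorem exists_large_degree (h : IsClassedMoebiusPlane I q cls) (𝒻 : Finset β)
    (hint : ∀ c ∈ 𝒻, ∀ d ∈ 𝒻, ∃ x, I x c ∧ I x d) (hq : 9 ≤ q)
    (hf : 707 / 1000 * (q : ℝ) ^ 2 + 2828 / 1000 * q + 8 ≤ #𝒻) :
    ∃ x, 7 / 2 * (q : ℝ) ≤ degree I 𝒻 x := by
  have hne : Nonempty α := Fintype.card_pos_iff.1 (by rw [h.card_points]; positivity)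
  obtain ⟨x₀, hx₀⟩ := Finite.exists_max (degree I 𝒻)
  refine ⟨x₀, ?_⟩
  set M := degree I 𝒻 x₀ with hM
  have hq' : (9 : ℝ) ≤ q := by exact_mod_cast hq
  have hf0 : (0 : ℝ) < #𝒻 := lt_of_lt_of_le (by positivity) hf
  set f : ℝ := ((#𝒻 : ℕ) : ℝ) with hfd
  obtain ⟨a, ha⟩ : ∃ a, ∑ x, degree I 𝒻 x ^ 2 = f * a :=
    ⟨(∑ x, degree I 𝒻 x ^ 2) / f, by field_simp⟩
  obtain ⟨w, hw⟩ : ∃ w, f = ((q : ℝ) ^ 2 + 1) * w :=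
    ⟨f / ((q : ℝ) ^ 2 + 1), by field_simp⟩
  have hN : (0 : ℝ) < (q : ℝ) ^ 2 + 1 := by positivity
  have hw0 : 0 < w := pos_of_mul_pos_right (hw ▸ hf0) hN.le
  have hT := h.sum_tangency_family_le 𝒻 hint
  have hV := h.sum_meet_family 𝒻 hint
  rw [← sum_degree_sq, ha] at hV
  rw [← hfd] at hT hV
  have ha1 : w * (2 * (q : ℝ) ^ 2 - q + 1) ≤ a := by
    have h1 : ((q : ℝ) ^ 2 + 1) * (f * a) ≥
        ((q : ℝ) ^ 2 + 1) * (2 * f ^ 2) - (q + 1) * f ^ 2 := by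
      rw [hV]; linarith
    have h2 : 0 ≤ ((q : ℝ) ^ 2 + 1) * f * (a - w * (2 * (q : ℝ) ^ 2 - q + 1)) := by
      rw [hw] at h1 ⊢
      linarith
    have h3 := nonneg_of_mul_nonneg_right h2 (by positivity)
    linarith
  have hr : ((q : ℝ) + 1) ^ 2 * f / (q ^ 2 + 1) = (q + 1) ^ 2 * w := by
    rw [hw]; field_simp
  obtain ⟨g, hg⟩ : ∃ g, a = (q + 1) ^ 2 * w + g := ⟨a - (q + 1) ^ 2 * w, by ring⟩
  have hg1 : w * ((q : ℝ) ^ 2 - 3 * q) ≤ g := by linarith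
  have hqq : 0 < (q : ℝ) ^ 2 - 3 * q := by nlinarith
  have hg0 : 0 < g := lt_of_lt_of_le (by positivity) hg1
  have t1 := h.third_moment_bound 𝒻 (a := a) (by rw [← hfd, hr]; linarith) ha
  have t2 := h.max_degree_moment_bound 𝒻 hx₀ ha ((q + 1) * w)
  rw [← hfd, hr] at t1
  rw [← hfd] at t2
  have hk : 0 < (q : ℝ) ^ 2 - 2 * q - 1 := by nlinarith
  have t3 := mul_le_mul_of_nonneg_left t2 hk.le
  have t4 : 0 ≤ (((q : ℝ) ^ 2 + 1) * w * g) * (((q : ℝ) ^ 2 - 2 * q - 1) * (M - (q + 1) * w)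
      - ((g + (q + 1) ^ 2 * w) * g - (q + 1) ^ 2 * w * (q ^ 2 - 1))) := by
    rw [hg, hw] at t1 t3
    linarith
  have t5 := nonneg_of_mul_nonneg_right t4 (by positivity)
  have t6 : (w * ((q : ℝ) ^ 2 - 3 * q) + (q + 1) ^ 2 * w) * (w * ((q : ℝ) ^ 2 - 3 * q)) ≤
      (g + (q + 1) ^ 2 * w) * g := by gcongr
  have t7 := degree_polynomial_bound hq' hf
  have t8 : 7 / 2 * (q : ℝ) * ((q : ℝ) ^ 2 - 2 * q - 1) ≤
      w * (w * (2 * q ^ 2 - q + 1) * ((q : ℝ) ^ 2 - 3 * q) - (q ^ 2 + 1) * q * (q + 1)) := by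
    refine le_of_mul_le_mul_right ?_ (by positivity : 0 < ((q : ℝ) ^ 2 + 1) ^ 2)
    rw [hw] at t7
    linarith
  refine le_of_mul_le_mul_right ?_ hk
  linarith

theorem all_through_point (h : IsClassedMoebiusPlane I q cls) (𝒻 : Finset β)
    (hint : ∀ c ∈ 𝒻, ∀ d ∈ 𝒻, ∃ x, I x c ∧ I x d) (hq : 9 ≤ q)
    (hf : 707 / 1000 * (q : ℝ) ^ 2 + 2828 / 1000 * q + 8 ≤ #𝒻) :
    ∃ x, ∀ c ∈ 𝒻, I x c := by
  classical
  obtain ⟨s, hs⟩ := h.exists_large_degree 𝒻 hint hq hf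
  refine ⟨s, ?_⟩
  by_contra! hcon
  obtain ⟨c₀, hc₀, hsc₀⟩ := hcon
  have hq' : (9 : ℝ) ≤ q := by exact_mod_cast hq
  set L : Finset β := 𝒻.filter (fun c => I s c) with hL
  have hLs : ∀ d ∈ L, I s d := fun d hd => (Finset.mem_filter.1 hd).2
  have hLf : ∀ d ∈ L, d ∈ 𝒻 := fun d hd => (Finset.mem_filter.1 hd).1
  have hdeg : degree I 𝒻 s = #L := by
    simp [degree, incidence, hL]
  set m : ℝ := ((#L : ℕ) : ℝ) with hm
  rw [hdeg] at hs
  have hm2 : m ≤ (q + 1) * (q + 2) / 2 := by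
    refine h.card_through_le hsc₀ L fun d hd => ⟨hLs d hd, ?_⟩
    obtain ⟨x, hx, hx'⟩ := hint c₀ hc₀ d (hLf d hd)
    exact meet_ne_zero hx hx'
  have hds : degree I L s = m := by
    have : ∀ c ∈ L, incidence I s c = 1 := fun c hc => by simp [incidence, hLs c hc]
    rw [degree, Finset.sum_congr rfl this]
    simp [hm]
  set v : α → ℝ := fun x => if x = s then 0 else degree I L x with hv
  have hvs : v s = 0 := by simp [hv]
  have hv1 : ∑ x, v x = m * q := by
    have e : ∀ x, v x = degree I L x - if x = s then degree I L x else 0 := by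
      intro x; simp only [hv]; split_ifs <;> simp
    simp only [e, Finset.sum_sub_distrib, Finset.sum_ite_eq', Finset.mem_univ, if_true, hds,
      h.sum_degree]
    rw [← hm]; ring
  have hv2 : ∑ x, v x ^ 2 ≤ m * q + m * (m - 1) := by
    have e : ∀ x, v x ^ 2 = degree I L x ^ 2 - if x = s then degree I L x ^ 2 else 0 := by
      intro x; simp only [hv]; split_ifs <;> simp
    simp only [e, Finset.sum_sub_distrib, Finset.sum_ite_eq', Finset.mem_univ, if_true, hds,
      sum_degree_sq]
    rw [h.sum_meet_family L fun c hc d hd => ⟨s, hLs c hc, hLs d hd⟩, ← hm]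
    have : 0 ≤ ∑ c ∈ L, ∑ d ∈ L, tangency I c d :=
      Finset.sum_nonneg fun c _ => Finset.sum_nonneg fun d _ => tangency_nonneg c d
    linarith
  have hx : ∀ c ∈ 𝒻 \ L, m - q - 1 ≤ weight I v c - m ∧ ¬ I s c := by
    intro c hc
    obtain ⟨hcf, hcL⟩ := Finset.mem_sdiff.1 hc
    have hsc : ¬ I s c := fun h' => hcL (Finset.mem_filter.2 ⟨hcf, h'⟩)
    refine ⟨?_, hsc⟩
    have e1 : weight I v c = ∑ d ∈ L, meet I d c := by
      rw [← weight_degree]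
      refine Finset.sum_congr rfl fun x _ => ?_
      by_cases hxs : x = s
      · subst hxs; simp [incidence, hsc]
      · simp [hv, hxs]
    have e2 : ∀ d ∈ L, meet I d c = 2 - tangency I c d := by
      intro d hd
      obtain ⟨x, hx, hx'⟩ := hint d (hLf d hd) c hcf
      rw [h.meet_eq_of_ne_zero (meet_ne_zero hx hx'), if_neg, tangency_comm, add_zero]
      rintro rfl
      exact hcL hd
    have e3 : ∑ d ∈ L, tangency I c d ≤ (q : ℝ) + 1 := by
      rw [← h.sum_incidence_mul_tangency hsc]
      calc ∑ d ∈ L, tangency I c d = ∑ d ∈ L, incidence I s d * tangency I c d :=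
            Finset.sum_congr rfl fun d hd => by simp [incidence, hLs d hd]
        _ ≤ _ := Finset.sum_le_univ_sum_of_nonneg fun d =>
            mul_nonneg (incidence_nonneg I s d) (tangency_nonneg c d)
    rw [e1, Finset.sum_congr rfl e2, Finset.sum_sub_distrib]
    simp only [Finset.sum_const, nsmul_eq_mul, ← hm]
    linarith
  have hlow : (#𝒻 - m) * (m - q - 1) ^ 2 ≤
      ∑ c, (1 - incidence I s c) * (weight I v c - m) ^ 2 := by
    have hi : ∀ c, 0 ≤ 1 - incidence I s c := by
      intro c; unfold incidence; split_ifs <;> simp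
    calc (#𝒻 - m) * (m - q - 1) ^ 2 = ∑ c ∈ 𝒻 \ L, (m - q - 1) ^ 2 := by
          rw [Finset.sum_const, nsmul_eq_mul, Finset.cast_card_sdiff (Finset.filter_subset _ _)]
      _ ≤ ∑ c ∈ 𝒻 \ L, (1 - incidence I s c) * (weight I v c - m) ^ 2 := by
          refine Finset.sum_le_sum fun c hc => ?_
          obtain ⟨h1, h2⟩ := hx c hc
          simp only [incidence, h2, if_false, sub_zero, one_mul]
          exact pow_le_pow_left₀ (by linarith) h1 2
      _ ≤ _ := Finset.sum_le_univ_sum_of_nonneg fun c => mul_nonneg (hi c) (sq_nonneg _)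
  have hup : ∑ c, (1 - incidence I s c) * (weight I v c - m) ^ 2 =
      ∑ c, weight I v c ^ 2 - 2 * m * ∑ c, weight I v c + m ^ 2 * ∑ _c : β, (1 : ℝ)
      - ∑ c, incidence I s c * weight I v c ^ 2
      + 2 * m * ∑ c, incidence I s c * weight I v c - m ^ 2 * ∑ c, incidence I s c := by
    simp only [Finset.mul_sum, ← Finset.sum_add_distrib, ← Finset.sum_sub_distrib]
    exact Finset.sum_congr rfl fun d _ => by ring
  rw [h.sum_weight_sq, h.sum_weight, h.sum_circles_one, h.sum_incidence_mul_weight_sq,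
    h.sum_incidence_mul_weight, h.sum_single, hv1, hvs] at hup
  have hk : 0 ≤ (q : ℝ) ^ 2 - q - 1 := by nlinarith
  have := mul_le_mul_of_nonneg_left hv2 hk
  have := stability_polynomial_bound hq' hf hs hm2
  linarith

end IsClassedMoebiusPlane

open scoped Classical in
theorem two_mul_card_class {F : Type*} [Field F] [Fintype F] (hF : ringChar F ≠ 2) (σ : Prop) :
    2 * #{c : F | c ≠ 0 ∧ (σ ↔ IsSquare c)} + 1 = Fintype.card F := by
  obtain ⟨ε, hε⟩ : ∃ ε : ℤ, ∀ c : F, 2 * (if c ≠ 0 ∧ (σ ↔ IsSquare c) then (1 : ℤ) else 0) +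
      (if c = 0 then 1 else 0) = 1 + ε * quadraticChar F c := by
    refine ⟨if σ then 1 else -1, fun c => ?_⟩
    rcases eq_or_ne c 0 with rfl | hc
    · simp
    · by_cases hs : IsSquare c
      · rw [(quadraticChar_one_iff_isSquare hc).2 hs]
        by_cases hσ : σ <;> simp [hc, hs, hσ]
      · rw [quadraticChar_neg_one_iff_not_isSquare.2 hs]
        by_cases hσ : σ <;> simp [hc, hs, hσ]
  have h1 := Finset.sum_congr (rfl : (univ : Finset F) = univ) fun c _ => hε c
  rw [Finset.sum_add_distrib, Finset.sum_add_distrib, ← Finset.mul_sum, ← Finset.mul_sum,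
    quadraticChar_sum_zero hF, Finset.sum_boole, Finset.sum_ite_eq' univ (0 : F) (fun _ => (1 : ℤ)),
    if_pos (Finset.mem_univ _), Finset.sum_const, Finset.card_univ] at h1
  simp only [nsmul_eq_mul, mul_one, mul_zero, add_zero] at h1
  exact_mod_cast h1

section Elliptic

variable {F V : Type*} [Field F] [AddCommGroup V] [Module F V]

theorem map_mk_rep_eq_zero_iff (κ : QuadraticForm F V) {v : V} (hv : v ≠ 0) :
    κ (Projectivization.mk F v hv).rep = 0 ↔ κ v = 0 := by
  obtain ⟨a, ha⟩ := Projectivization.exists_smul_eq_mk_rep F v hv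
  rw [← ha, Units.smul_def, QuadraticMap.map_smul]
  simp

theorem polar_mk_rep_eq_zero_iff (κ : QuadraticForm F V) (s : V) {v : V} (hv : v ≠ 0) :
    QuadraticMap.polar κ s (Projectivization.mk F v hv).rep = 0 ↔ QuadraticMap.polar κ s v = 0 := by
  obtain ⟨a, ha⟩ := Projectivization.exists_smul_eq_mk_rep F v hv
  rw [← ha, Units.smul_def, QuadraticMap.polar_smul_right]
  simp

theorem ncard_projectivization [Finite F] [Finite V] {p : V → Prop}
    (hp : ∀ (a : Fˣ) v, p v → p (a • v)) :
    {P : ℙ F V | p P.rep}.ncard * (Nat.card F - 1) = {v : V | v ≠ 0 ∧ p v}.ncard := by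
  have h1 : (fun z : ℙ F V × Fˣ => z.2 • z.1.rep) '' ({P : ℙ F V | p P.rep} ×ˢ Set.univ) =
      {v : V | v ≠ 0 ∧ p v} := by
    ext v
    constructor
    · rintro ⟨⟨P, a⟩, ⟨hP, -⟩, rfl⟩
      exact ⟨(smul_ne_zero_iff_ne a).2 P.rep_nonzero, hp a _ hP⟩
    · rintro ⟨hv, hpv⟩
      obtain ⟨a, ha⟩ := Projectivization.exists_smul_eq_mk_rep F v hv
      refine ⟨(Projectivization.mk F v hv, a⁻¹), ⟨?_, trivial⟩, ?_⟩
      · change p _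
        rw [← ha]
        exact hp a v hpv
      · change a⁻¹ • (Projectivization.mk F v hv).rep = v
        rw [← ha, inv_smul_smul]
  have h2 : Function.Injective (fun z : ℙ F V × Fˣ => z.2 • z.1.rep) := by
    rintro ⟨P, a⟩ ⟨Q, b⟩ hab
    change a • P.rep = b • Q.rep at hab
    have hPQ : P = Q := by
      rw [← P.mk_rep, ← Q.mk_rep, Projectivization.mk_eq_mk_iff]
      exact ⟨a⁻¹ * b, by rw [mul_smul, ← hab, inv_smul_smul]⟩
    subst hPQ
    have hab' : (a : F) = b := smul_left_injective F P.rep_nonzero hab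
    rw [Units.ext hab']
  rw [← h1, Set.ncard_image_of_injective _ h2, Set.ncard_prod, Set.ncard_univ, Nat.card_units]

theorem polarBilin_nondegenerate {κ : QuadraticForm F V}
    (hnd : ∀ x : V, (∀ y : V, QuadraticMap.polar κ x y = 0) → x = 0) :
    κ.polarBilin.Nondegenerate := by
  refine ⟨hnd, fun y hy => hnd y fun x => ?_⟩
  rw [QuadraticMap.polar_comm]
  exact hy x

theorem polarBilin_isRefl (κ : QuadraticForm F V) : κ.polarBilin.IsRefl := by
  intro x y h
  change QuadraticMap.polar κ y x = 0
  rw [QuadraticMap.polar_comm]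
  exact h

theorem mem_orthogonal_span_range (κ : QuadraticForm F V) {ι : Type*} (v : ι → V) (x : V) :
    x ∈ LinearMap.BilinForm.orthogonal κ.polarBilin (Submodule.span F (Set.range v)) ↔
      ∀ i, QuadraticMap.polar κ (v i) x = 0 := by
  rw [LinearMap.BilinForm.mem_orthogonal_iff]
  constructor
  · intro h i
    exact h _ (Submodule.subset_span ⟨i, rfl⟩)
  · intro h y hy
    induction hy using Submodule.span_induction with
    | mem y hy => obtain ⟨i, rfl⟩ := hy; exact h i
    | zero => exact QuadraticMap.polar_zero_left κ x
    | add y z _ _ hy hz =>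
      change QuadraticMap.polar κ (y + z) x = 0
      rw [QuadraticMap.polar_add_left]
      exact (congrArg₂ (· + ·) hy hz).trans (add_zero 0)
    | smul a y _ hy =>
      change QuadraticMap.polar κ (a • y) x = 0
      rw [QuadraticMap.polar_smul_left]
      exact (congrArg (a • ·) hy).trans (smul_zero a)

variable [FiniteDimensional F V]

theorem mem_span_range_of_polar {κ : QuadraticForm F V}
    (hnd : ∀ x : V, (∀ y : V, QuadraticMap.polar κ x y = 0) → x = 0) {ι : Type*} (v : ι → V)
    {s : V} (hs : ∀ y, (∀ i, QuadraticMap.polar κ (v i) y = 0) → QuadraticMap.polar κ s y = 0) :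
    s ∈ Submodule.span F (Set.range v) := by
  rw [← LinearMap.BilinForm.orthogonal_orthogonal (polarBilin_nondegenerate hnd)
    (polarBilin_isRefl κ) (Submodule.span F (Set.range v)), LinearMap.BilinForm.mem_orthogonal_iff]
  intro y hy
  rw [mem_orthogonal_span_range] at hy
  change QuadraticMap.polar κ y s = 0
  rw [QuadraticMap.polar_comm]
  exact hs y hy

theorem ncard_polar_eq_zero [Finite F] {κ : QuadraticForm F V}
    (hnd : ∀ x : V, (∀ y : V, QuadraticMap.polar κ x y = 0) → x = 0) {k : ℕ} {v : Fin k → V}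
    (hv : LinearIndependent F v) :
    {x | ∀ i, QuadraticMap.polar κ (v i) x = 0}.ncard =
      Nat.card F ^ (Module.finrank F V - k) := by
  have h1 : {x | ∀ i, QuadraticMap.polar κ (v i) x = 0} =
      (LinearMap.BilinForm.orthogonal κ.polarBilin (Submodule.span F (Set.range v)) : Set V) := by
    ext x
    exact (mem_orthogonal_span_range κ v x).symm
  rw [h1, ← Nat.card_coe_set_eq]
  change Nat.card (LinearMap.BilinForm.orthogonal κ.polarBilin (Submodule.span F (Set.range v))) = _
  rw [Module.natCard_eq_pow_finrank (K := F),
    LinearMap.BilinForm.finrank_orthogonal (polarBilin_nondegenerate hnd),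
    finrank_span_eq_card hv, Fintype.card_fin]

theorem ncard_points_polar_eq_zero [Finite F] {κ : QuadraticForm F V}
    (hnd : ∀ x : V, (∀ y : V, QuadraticMap.polar κ x y = 0) → x = 0) {k : ℕ} {v : Fin k → V}
    (hv : LinearIndependent F v) :
    {P : ℙ F V | ∀ i, QuadraticMap.polar κ (v i) P.rep = 0}.ncard * (Nat.card F - 1) =
      Nat.card F ^ (Module.finrank F V - k) - 1 := by
  have : Finite V := Module.finite_of_finite F
  rw [ncard_projectivization (p := fun x => ∀ i, QuadraticMap.polar κ (v i) x = 0),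
    ← ncard_polar_eq_zero hnd hv]
  · have : {x : V | x ≠ 0 ∧ ∀ i, QuadraticMap.polar κ (v i) x = 0} =
        {x | ∀ i, QuadraticMap.polar κ (v i) x = 0} \ {0} := by
      ext x; simp [and_comm]
    rw [this, Set.ncard_sdiff_singleton_of_mem]
    exact fun i => QuadraticMap.polar_zero_right κ (v i)
  · intro a x hx i
    rw [Units.smul_def, QuadraticMap.polar_smul_right, hx i, smul_zero]

end Elliptic

/-- A nondegenerate quadratic form in four variables over a finite field of odd order `q` whose
isotropic points form an elliptic quadric. -/
structure IsElliptic {F V : Type*} [Field F] [AddCommGroup V] [Module F V]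
    (κ : QuadraticForm F V) (q : ℕ) : Prop where
  odd : Odd q
  card_field : Nat.card F = q
  finrank_eq : Module.finrank F V = 4
  nondegenerate : ∀ x : V, (∀ y : V, QuadraticMap.polar κ x y = 0) → x = 0
  ncard_isotropic : {P : ℙ F V | κ P.rep = 0}.ncard = q ^ 2 + 1

namespace IsElliptic

open QuadraticMap

variable {F V : Type*} [Field F] [AddCommGroup V] [Module F V] {κ : QuadraticForm F V} {q : ℕ}

theorem finite_field (h : IsElliptic κ q) : Finite F := by
  refine Nat.finite_of_card_ne_zero ?_
  rw [h.card_field]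
  exact h.odd.pos.ne'

theorem finiteDimensional (h : IsElliptic κ q) : FiniteDimensional F V :=
  FiniteDimensional.of_finrank_pos (by rw [h.finrank_eq]; norm_num)

theorem finite (h : IsElliptic κ q) : Finite V :=
  have := h.finite_field
  have := h.finiteDimensional
  Module.finite_of_finite F

theorem three_le (h : IsElliptic κ q) : 3 ≤ q := by
  have := h.finite_field
  have h1 : 1 < Nat.card F := Finite.one_lt_card
  rw [h.card_field] at h1
  obtain ⟨k, hk⟩ := h.odd
  omega

theorem two_ne_zero (h : IsElliptic κ q) : (2 : F) ≠ 0 := by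
  have := h.finite_field
  have := Fintype.ofFinite F
  refine Ring.two_ne_zero fun h2 => ?_
  have h3 := FiniteField.even_card_of_char_two h2
  rw [← Nat.card_eq_fintype_card, h.card_field] at h3
  have := Nat.odd_iff.1 h.odd
  omega

theorem map_add_smul (κ : QuadraticForm F V) (x s : V) (a b : F) :
    κ (a • x + b • s) = a * a * κ x + b * b * κ s + a * b * polar κ x s := by
  rw [QuadraticMap.map_add κ, QuadraticMap.map_smul, QuadraticMap.map_smul, polar_smul_left,
    polar_smul_right]
  simp only [smul_eq_mul]
  ring

theorem polar_self_of_isotropic {s : V} (hs : κ s = 0) : polar κ s s = 0 := by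
  rw [polar_self, hs, smul_zero]

theorem exists_polar_eq_one (h : IsElliptic κ q) {s : V} (hs : s ≠ 0) :
    ∃ v, polar κ s v = 1 := by
  by_contra! hcon
  refine hs (h.nondegenerate s fun y => ?_)
  by_contra hy
  refine hcon ((polar κ s y)⁻¹ • y) ?_
  rw [polar_smul_right, smul_eq_mul, inv_mul_cancel₀ hy]

theorem ncard_points_polar (h : IsElliptic κ q) {k n : ℕ} {v : Fin k → V}
    (hv : LinearIndependent F v) (hn : n * (q - 1) = q ^ (4 - k) - 1) :
    {P : ℙ F V | ∀ i, polar κ (v i) P.rep = 0}.ncard = n := by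
  have := h.finite_field
  have := h.finiteDimensional
  have h1 := ncard_points_polar_eq_zero h.nondegenerate hv
  rw [h.card_field, h.finrank_eq, ← hn] at h1
  exact Nat.eq_of_mul_eq_mul_right (by have := h.three_le; omega) h1

theorem ncard_isotropic_polar_le_one (h : IsElliptic κ q) {s : V} (hs0 : s ≠ 0) (hs : κ s = 0) :
    {P : ℙ F V | κ P.rep = 0 ∧ polar κ s P.rep = 0}.ncard ≤ 1 := by
  have := h.finite_field
  have := h.finiteDimensional
  have := h.finite
  obtain ⟨v₀, hv₀⟩ := h.exists_polar_eq_one hs0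
  have hss := polar_self_of_isotropic hs
  have hA : {v | polar κ s v = 1}.ncard = q ^ 3 := by
    have h1 := ncard_polar_eq_zero h.nondegenerate (v := ![s])
      (linearIndependent_unique_iff.2 hs0)
    rw [h.card_field, h.finrank_eq] at h1
    have h2 : (fun x => v₀ + x) '' {x | ∀ i, polar κ (![s] i) x = 0} = {v | polar κ s v = 1} := by
      ext v
      constructor
      · rintro ⟨x, hx, rfl⟩
        have := hx 0
        simp only [Matrix.cons_val_zero] at this
        simp [polar_add_right, hv₀, this]
      · intro hv
        refine ⟨v - v₀, fun i => ?_, by simp⟩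
        have hi : i = 0 := Subsingleton.elim _ _
        subst hi
        simp only [Set.mem_ofPred_eq] at hv
        simp [polar_sub_right, hv₀, hv]
    rw [← h2, Set.ncard_image_of_injective _ (add_right_injective v₀), h1]
  set D : Set (ℙ F V) := {P | κ P.rep = 0 ∧ polar κ s P.rep ≠ 0} with hD
  have h3 : {v | polar κ s v = 1} ⊆
      (fun z : ℙ F V × F => (polar κ s z.1.rep)⁻¹ • z.1.rep + z.2 • s) '' (D ×ˢ Set.univ) := by
    intro v hv
    simp only [Set.mem_ofPred_eq] at hv
    have hy1 : polar κ s (v - κ v • s) = 1 := by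
      rw [polar_sub_right, polar_smul_right, hv, hss, smul_zero, sub_zero]
    have hy0 : v - κ v • s ≠ 0 := by
      intro h0
      rw [h0, polar_zero_right] at hy1
      exact zero_ne_one hy1
    have hκ : κ (v - κ v • s) = 0 := by
      have := map_add_smul κ v s 1 (-κ v)
      rw [one_smul, neg_smul, ← sub_eq_add_neg, polar_comm, hv, hs] at this
      rw [this]; ring
    refine ⟨(Projectivization.mk F _ hy0, κ v), ⟨⟨?_, ?_⟩, trivial⟩, ?_⟩
    · exact (map_mk_rep_eq_zero_iff κ hy0).2 hκ
    · rw [Ne, polar_mk_rep_eq_zero_iff, hy1]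
      exact one_ne_zero
    · obtain ⟨a, ha⟩ := Projectivization.exists_smul_eq_mk_rep F _ hy0
      simp only [← ha, Units.smul_def, polar_smul_right, hy1, smul_eq_mul, mul_one]
      rw [smul_smul, inv_mul_cancel₀ a.ne_zero, one_smul, sub_add_cancel]
  have h4 := (Set.ncard_le_ncard h3 (Set.toFinite _)).trans (Set.ncard_image_le (Set.toFinite _))
  rw [hA, Set.ncard_prod, Set.ncard_univ, h.card_field, pow_succ] at h4
  have h5 := Nat.le_of_mul_le_mul_right h4 h.odd.pos
  have h6 : D ∪ {P : ℙ F V | κ P.rep = 0 ∧ polar κ s P.rep = 0} = {P : ℙ F V | κ P.rep = 0} := by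
    ext P
    simp only [hD, Set.mem_union, Set.mem_ofPred_eq]
    tauto
  have h7 : Disjoint D {P : ℙ F V | κ P.rep = 0 ∧ polar κ s P.rep = 0} := by
    rw [Set.disjoint_left]
    exact fun P hP hP' => hP.2 hP'.2
  have h8 := Set.ncard_union_eq h7 (Set.toFinite _) (Set.toFinite _)
  rw [h6, h.ncard_isotropic] at h8
  omega

theorem eq_of_polar_eq_zero (h : IsElliptic κ q) {S X : ℙ F V} (hS : κ S.rep = 0)
    (hX : κ X.rep = 0) (hSX : polar κ S.rep X.rep = 0) : S = X := by
  have := h.finite_field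
  have := h.finite
  exact (Set.ncard_le_one (Set.toFinite _)).1 (h.ncard_isotropic_polar_le_one S.rep_nonzero hS) S
    ⟨hS, polar_self_of_isotropic hS⟩ X ⟨hX, hSX⟩

theorem linearIndependent_pair {s x : V} (hs : κ s = 0) (hx : κ x = 0)
    (hsx : polar κ s x ≠ 0) : LinearIndependent F ![s, x] := by
  rw [LinearIndependent.pair_iff]
  intro a b hab
  have h1 := congrArg (polar κ s) hab
  have h2 := congrArg (polar κ x) hab
  rw [polar_add_right, polar_smul_right, polar_smul_right, polar_self_of_isotropic hs] at h1
  rw [polar_add_right, polar_smul_right, polar_smul_right, polar_self_of_isotropic hx,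
    polar_comm] at h2
  simp only [polar_zero_right, smul_eq_mul, mul_zero, zero_add, add_zero, mul_eq_zero, hsx,
    or_false] at h1 h2
  exact ⟨h2, h1⟩

theorem linearIndependent_triple {s x y : V} (hs : κ s = 0) (hx : κ x = 0) (hy : κ y = 0)
    (hsx : polar κ s x ≠ 0) (hxy : polar κ x y ≠ 0) (hsy : polar κ s y ≠ 0) :
    LinearIndependent F ![s, x, y] := by
  rw [Fintype.linearIndependent_iff]
  intro g hg
  simp only [Fin.sum_univ_three, Matrix.cons_val_zero, Matrix.cons_val_one, Matrix.cons_val] at hg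
  have e1 : g 0 * g 1 = 0 := by
    have h1 : g 0 • s + g 1 • x = -(g 2 • y) := eq_neg_of_add_eq_zero_left hg
    have h2 := map_add_smul κ s x (g 0) (g 1)
    rw [h1, QuadraticMap.map_neg, QuadraticMap.map_smul, hs, hx, hy] at h2
    simp only [smul_eq_mul, mul_zero, zero_add] at h2
    exact (mul_eq_zero.1 h2.symm).resolve_right hsx
  have p : ∀ z, g 0 * polar κ z s + g 1 * polar κ z x + g 2 * polar κ z y = 0 := by
    intro z
    have := congrArg (polar κ z) hg
    simpa only [polar_add_right, polar_smul_right, polar_zero_right, smul_eq_mul] using this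
  have p0 := p s
  have p1 := p x
  have p2 := p y
  rw [polar_self_of_isotropic hs] at p0
  rw [polar_self_of_isotropic hx, polar_comm κ x s] at p1
  rw [polar_self_of_isotropic hy, polar_comm κ y s, polar_comm κ y x] at p2
  have e : g 0 = 0 ∧ g 1 = 0 := by
    rcases mul_eq_zero.1 e1 with e | e
    · simp only [e, zero_mul, mul_zero, zero_add, add_zero, mul_eq_zero, hxy, or_false] at p2
      exact ⟨e, p2⟩
    · simp only [e, zero_mul, mul_zero, add_zero, mul_eq_zero, hsy, or_false] at p2
      exact ⟨p2, e⟩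
  rw [e.1, e.2] at p0
  simp only [zero_mul, zero_add, mul_eq_zero, hsy, or_false] at p0
  intro i
  fin_cases i
  · exact e.1
  · exact e.2
  · exact p0

/-- The isotropic points. -/
abbrev Point (κ : QuadraticForm F V) : Type _ := {S : ℙ F V // κ S.rep = 0}

/-- The non-isotropic points whose polar plane contains an isotropic point. -/
abbrev Circle (κ : QuadraticForm F V) : Type _ :=
  {P : ℙ F V // κ P.rep ≠ 0 ∧ ∃ S : ℙ F V, κ S.rep = 0 ∧ polar κ S.rep P.rep = 0}

/-- Incidence of isotropic points and circles. -/
def Inc (κ : QuadraticForm F V) (S : Point κ) (P : Circle κ) : Prop :=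
  polar κ S.1.rep P.1.rep = 0

theorem card_filter_subtype {γ : Type*} [Finite γ] (r p : γ → Prop) [Fintype {x // r x}]
    [DecidablePred fun c : {x // r x} => p c] :
    #{c : {x // r x} | p c} = {x | r x ∧ p x}.ncard := by
  have h1 : {x | r x ∧ p x} = Subtype.val ''
      (({c : {x // r x} | p c} : Finset {x // r x}) : Set {x // r x}) := by
    ext x; simp [and_comm]
  rw [h1, Set.ncard_image_of_injective _ Subtype.val_injective, Set.ncard_coe_finset]

theorem polar_ne_zero (h : IsElliptic κ q) {S X : Point κ} (hSX : S ≠ X) :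
    polar κ S.1.rep X.1.rep ≠ 0 :=
  fun h0 => hSX (Subtype.ext (h.eq_of_polar_eq_zero S.2 X.2 h0))

theorem isMoebiusPlane (h : IsElliptic κ q) [Fintype (Point κ)] [Fintype (Circle κ)] :
    IsMoebiusPlane (Inc κ) q := by
  classical
  have := h.finite_field
  have := h.finite
  have hq := h.three_le
  obtain ⟨r, rfl⟩ : ∃ r, q = r + 1 := ⟨q - 1, by omega⟩
  refine ⟨by omega, ?_, ?_, ?_, ?_, ?_⟩
  · rw [← h.ncard_isotropic, ← Nat.card_eq_fintype_card]
    exact Nat.card_coe_set_eq {P : ℙ F V | κ P.rep = 0}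
  · intro S
    have h1 := h.ncard_points_polar (n := (r + 1) ^ 2 + (r + 1) + 1) (v := ![S.1.rep])
      (linearIndependent_unique_iff.2 S.1.rep_nonzero)
      (by
        rw [Nat.add_sub_cancel, eq_comm]
        apply Nat.sub_eq_of_eq_add
        norm_num
        ring)
    have h2 : {P : ℙ F V | ((κ P.rep ≠ 0 ∧ ∃ S : ℙ F V, κ S.rep = 0 ∧ polar κ S.rep P.rep = 0)) ∧
        polar κ S.1.rep P.rep = 0} =
        {P : ℙ F V | ∀ i, polar κ (![S.1.rep] i) P.rep = 0} \ {S.1} := by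
      ext P
      simp only [Set.mem_ofPred_eq, Set.mem_sdiff, Set.mem_singleton_iff, Fin.forall_fin_one,
        Matrix.cons_val_zero]
      constructor
      · rintro ⟨⟨h3, -⟩, h4⟩
        refine ⟨h4, ?_⟩
        rintro rfl
        exact h3 S.2
      · rintro ⟨h3, h4⟩
        exact ⟨⟨fun h5 => h4 (h.eq_of_polar_eq_zero S.2 h5 h3).symm, S.1, S.2, h3⟩, h3⟩
    refine (card_filter_subtype _ fun P : ℙ F V => polar κ S.1.rep P.rep = 0).trans ?_
    rw [h2, Set.ncard_sdiff_singleton_of_mem, h1, Nat.add_sub_cancel]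
    simp [polar_self_of_isotropic S.2]
  · intro S X hSX
    have h1 := h.ncard_points_polar (n := (r + 1) + 1) (v := ![S.1.rep, X.1.rep])
      (linearIndependent_pair S.2 X.2 (h.polar_ne_zero hSX))
      (by
        rw [Nat.add_sub_cancel, eq_comm]
        apply Nat.sub_eq_of_eq_add
        norm_num
        ring)
    have h2 : {P : ℙ F V | ((κ P.rep ≠ 0 ∧ ∃ S : ℙ F V, κ S.rep = 0 ∧ polar κ S.rep P.rep = 0)) ∧
        polar κ S.1.rep P.rep = 0 ∧ polar κ X.1.rep P.rep = 0} =
        {P : ℙ F V | ∀ i, polar κ (![S.1.rep, X.1.rep] i) P.rep = 0} := by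
      ext P
      simp only [Set.mem_ofPred_eq, Fin.forall_fin_two, Matrix.cons_val_zero, Matrix.cons_val_one]
      refine ⟨fun h3 => h3.2, fun h3 => ⟨⟨fun h5 => hSX (Subtype.ext ?_), S.1, S.2, h3.1⟩, h3⟩⟩
      exact (h.eq_of_polar_eq_zero S.2 h5 h3.1).trans (h.eq_of_polar_eq_zero X.2 h5 h3.2).symm
    refine (card_filter_subtype _ fun P : ℙ F V =>
      polar κ S.1.rep P.rep = 0 ∧ polar κ X.1.rep P.rep = 0).trans ?_
    rw [h2, h1]
  · intro S X Y hSX hXY hSY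
    have h1 := h.ncard_points_polar (n := 1) (v := ![S.1.rep, X.1.rep, Y.1.rep])
      (linearIndependent_triple S.2 X.2 Y.2 (h.polar_ne_zero hSX) (h.polar_ne_zero hXY)
        (h.polar_ne_zero hSY)) (by norm_num)
    have h2 : {P : ℙ F V | ((κ P.rep ≠ 0 ∧ ∃ S : ℙ F V, κ S.rep = 0 ∧ polar κ S.rep P.rep = 0)) ∧
        polar κ S.1.rep P.rep = 0 ∧ polar κ X.1.rep P.rep = 0 ∧ polar κ Y.1.rep P.rep = 0} =
        {P : ℙ F V | ∀ i, polar κ (![S.1.rep, X.1.rep, Y.1.rep] i) P.rep = 0} := by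
      ext P
      simp only [Set.mem_ofPred_eq, Fin.forall_fin_succ, Matrix.cons_val_zero, Matrix.cons_val_succ,
        IsEmpty.forall_iff, and_true]
      refine ⟨fun h3 => h3.2, fun h3 => ⟨⟨fun h5 => hSX (Subtype.ext ?_), S.1, S.2, h3.1⟩, h3⟩⟩
      exact (h.eq_of_polar_eq_zero S.2 h5 h3.1).trans (h.eq_of_polar_eq_zero X.2 h5 h3.2.1).symm
    refine (card_filter_subtype _ fun P : ℙ F V =>
      polar κ S.1.rep P.rep = 0 ∧ polar κ X.1.rep P.rep = 0 ∧ polar κ Y.1.rep P.rep = 0).trans ?_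
    rw [h2, h1]
  · rintro ⟨P, hP, S, hS, hSP⟩
    exact ⟨⟨S, hS⟩, hSP⟩

theorem eq_of_rep_eq_smul {P R : ℙ F V} {a : F} (h : R.rep = a • P.rep) : P = R := by
  rw [← P.mk_rep, ← R.mk_rep, eq_comm]
  exact (Projectivization.mk_eq_mk_iff' F _ _ R.rep_nonzero P.rep_nonzero).2 ⟨a, h.symm⟩

theorem exists_inc_of_isotropic {x : V} (hx0 : x ≠ 0) (hx : κ x = 0) :
    ∃ X : Point κ, (∀ P : Circle κ, Inc κ X P ↔ polar κ x P.1.rep = 0) ∧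
      ∀ v, polar κ v X.1.rep = 0 ↔ polar κ v x = 0 := by
  refine ⟨⟨Projectivization.mk F x hx0, (map_mk_rep_eq_zero_iff κ hx0).2 hx⟩, fun P => ?_,
    fun v => polar_mk_rep_eq_zero_iff κ v hx0⟩
  rw [Inc, polar_comm, polar_mk_rep_eq_zero_iff, polar_comm]

theorem exists_rep_eq_of_tangent (h : IsElliptic κ q) {P R : Circle κ} {S : Point κ}
    (hSP : Inc κ S P) (hSR : Inc κ S R) (hu : ∀ X, Inc κ X P → Inc κ X R → X = S) :
    ∃ a b : F, R.1.rep = a • P.1.rep + b • S.1.rep := by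
  have := h.finiteDimensional
  have hs : S.1.rep ∈ Submodule.span F (Set.range ![P.1.rep, R.1.rep]) := by
    refine mem_span_range_of_polar h.nondegenerate _ fun y hy => ?_
    by_contra hsy
    have hyP : polar κ P.1.rep y = 0 := hy 0
    have hyR : polar κ R.1.rep y = 0 := hy 1
    have hSP' : polar κ P.1.rep S.1.rep = 0 := by rw [polar_comm]; exact hSP
    have hSR' : polar κ R.1.rep S.1.rep = 0 := by rw [polar_comm]; exact hSR
    have hx : κ (y + (-(κ y / polar κ S.1.rep y)) • S.1.rep) = 0 := by
      have h1 := map_add_smul κ y S.1.rep 1 (-(κ y / polar κ S.1.rep y))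
      rw [one_smul, S.2, polar_comm κ y] at h1
      rw [h1]
      field_simp
      ring
    have hsx : polar κ S.1.rep (y + (-(κ y / polar κ S.1.rep y)) • S.1.rep) ≠ 0 := by
      rw [polar_add_right, polar_smul_right, polar_self_of_isotropic S.2, smul_zero, add_zero]
      exact hsy
    have hx0 : y + (-(κ y / polar κ S.1.rep y)) • S.1.rep ≠ 0 := by
      intro h0
      rw [h0, polar_zero_right] at hsx
      exact hsx rfl
    obtain ⟨X, hX, hX'⟩ := exists_inc_of_isotropic hx0 hx
    refine hsx ((hX' _).1 ?_)
    rw [hu X ((hX P).2 ?_) ((hX R).2 ?_)]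
    · exact polar_self_of_isotropic S.2
    · rw [polar_comm, polar_add_right, polar_smul_right, hyP, hSP', smul_zero, add_zero]
    · rw [polar_comm, polar_add_right, polar_smul_right, hyR, hSR', smul_zero, add_zero]
  rw [Matrix.range_cons_cons_empty, Submodule.mem_span_pair] at hs
  obtain ⟨c, d, hcd⟩ := hs
  have hd : d ≠ 0 := by
    rintro rfl
    rw [zero_smul, add_zero] at hcd
    have h1 := S.2
    rw [← hcd, QuadraticMap.map_smul, smul_eq_mul, mul_eq_zero, mul_self_eq_zero] at h1
    rw [h1.resolve_right P.2.1, zero_smul] at hcd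
    exact S.1.rep_nonzero hcd.symm
  refine ⟨-(d⁻¹ * c), d⁻¹, ?_⟩
  rw [← hcd, smul_add, smul_smul, smul_smul, inv_mul_cancel₀ hd, one_smul, neg_smul]
  abel

theorem map_rep_of_tangent {P R : Circle κ} {S : Point κ} (hSP : Inc κ S P) {a b : F}
    (hR : R.1.rep = a • P.1.rep + b • S.1.rep) : κ R.1.rep = a * a * κ P.1.rep := by
  rw [hR, map_add_smul, S.2, polar_comm, hSP]
  ring

theorem ne_zero_of_tangent {P R : Circle κ} {S : Point κ} (hSP : Inc κ S P) {a b : F}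
    (hR : R.1.rep = a • P.1.rep + b • S.1.rep) : a ≠ 0 := by
  rintro rfl
  apply R.2.1
  rw [map_rep_of_tangent hSP hR]
  ring

open scoped Classical in
theorem exists_of_card_eq_one (h : IsElliptic κ q) [Fintype (Point κ)] {P R : Circle κ}
    (hPR : #{x | Inc κ x P ∧ Inc κ x R} = 1) :
    ∃ (S : Point κ) (a b : F), Inc κ S P ∧ Inc κ S R ∧ (∀ X, Inc κ X P → Inc κ X R → X = S) ∧
      R.1.rep = a • P.1.rep + b • S.1.rep := by
  obtain ⟨S, hS⟩ := Finset.card_eq_one.1 hPR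
  have hS' : ∀ X, (Inc κ X P ∧ Inc κ X R) ↔ X = S := fun X => by
    have := Finset.ext_iff.1 hS X
    simpa using this
  obtain ⟨h1, h2⟩ := (hS' S).2 rfl
  have h3 : ∀ X, Inc κ X P → Inc κ X R → X = S := fun X hX hX' => (hS' X).1 ⟨hX, hX'⟩
  obtain ⟨a, b, hab⟩ := h.exists_rep_eq_of_tangent h1 h2 h3
  exact ⟨S, a, b, h1, h2, h3, hab⟩

open scoped Classical in
theorem isSquare_iff_of_tangent (h : IsElliptic κ q) [Fintype (Point κ)] {P R : Circle κ}
    (hPR : #{x | Inc κ x P ∧ Inc κ x R} = 1) :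
    IsSquare (κ P.1.rep) ↔ IsSquare (κ R.1.rep) := by
  obtain ⟨S, a, b, h1, -, -, h2⟩ := h.exists_of_card_eq_one hPR
  have ha := ne_zero_of_tangent h1 h2
  rw [map_rep_of_tangent h1 h2]
  refine ⟨fun h3 => (IsSquare.mul_self a).mul h3, fun h3 => ?_⟩
  have h4 := (IsSquare.mul_self a⁻¹).mul h3
  have h5 : a⁻¹ * a⁻¹ * (a * a * κ P.1.rep) = κ P.1.rep := by field_simp
  rwa [h5] at h4

open scoped Classical in
theorem polar_sq_of_tangent (h : IsElliptic κ q) [Fintype (Point κ)] {P R : Circle κ}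
    (hPR : #{x | Inc κ x P ∧ Inc κ x R} = 1) :
    polar κ P.1.rep R.1.rep ^ 2 = 4 * κ P.1.rep * κ R.1.rep := by
  obtain ⟨S, a, b, h1, -, -, h2⟩ := h.exists_of_card_eq_one hPR
  have h3 : polar κ P.1.rep S.1.rep = 0 := by rw [polar_comm]; exact h1
  rw [map_rep_of_tangent h1 h2, h2, polar_add_right, polar_smul_right, polar_smul_right, h3,
    polar_self]
  simp only [smul_eq_mul, nsmul_eq_mul]
  push_cast
  ring

theorem exists_eq_smul_of_polar_triple (h : IsElliptic κ q) {s u v d : V} (hs : κ s = 0)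
    (hsu : polar κ s u = 0) (hsv : polar κ s v = 0) (hli : LinearIndependent F ![s, u, v])
    (hd : polar κ s d = 0) (hud : polar κ u d = 0) (hvd : polar κ v d = 0) :
    ∃ a : F, d = a • s := by
  have := h.finite_field
  have := h.finiteDimensional
  have := h.finite
  have hs0 : s ≠ 0 := hli.ne_zero 0
  have h1 := ncard_polar_eq_zero h.nondegenerate hli
  have h2 : (fun a : F => a • s) '' Set.univ ⊆ {x | ∀ i, polar κ (![s, u, v] i) x = 0} := by
    rintro _ ⟨a, -, rfl⟩ i
    fin_cases i
    · simp [polar_smul_right, polar_self_of_isotropic hs]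
    · simp [polar_smul_right, polar_comm κ u s, hsu]
    · simp [polar_smul_right, polar_comm κ v s, hsv]
  have h3 := Set.eq_of_subset_of_ncard_le h2 (by
    rw [h1, Set.ncard_image_of_injective _ (smul_left_injective F hs0), Set.ncard_univ,
      h.finrank_eq, pow_one]) (Set.toFinite _)
  have h4 : d ∈ {x | ∀ i, polar κ (![s, u, v] i) x = 0} := by
    intro i
    fin_cases i
    · exact hd
    · exact hud
    · exact hvd
  rw [← h3] at h4
  obtain ⟨a, -, ha⟩ := h4
  exact ⟨a, ha.symm⟩

/-- A vector off the tangent plane of `s`, normalised by its product with `s`, is determined by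
its norm and its products with a basis of a complement of `s` in the tangent plane. -/
theorem eq_of_polar_eq (h : IsElliptic κ q) {s u v x y : V} (hs : κ s = 0)
    (hsu : polar κ s u = 0) (hsv : polar κ s v = 0) (hli : LinearIndependent F ![s, u, v])
    (hx : polar κ s x = 1) (hy : polar κ s y = 1) (hu : polar κ u x = polar κ u y)
    (hv : polar κ v x = polar κ v y) (hκ : κ x = κ y) : x = y := by
  obtain ⟨a, ha⟩ := h.exists_eq_smul_of_polar_triple (d := x - y) hs hsu hsv hli
    (by rw [polar_sub_right, hx, hy, sub_self]) (by rw [polar_sub_right, hu, sub_self])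
    (by rw [polar_sub_right, hv, sub_self])
  have h1 : x = (1 : F) • y + a • s := by rw [one_smul, ← ha]; abel
  have h2 := map_add_smul κ y s 1 a
  rw [← h1, hs, hκ, polar_comm, hy] at h2
  have ha0 : a = 0 := by linear_combination -h2
  rw [h1, ha0, one_smul, zero_smul, add_zero]

/-- The representative of `R` whose product with the representative of `S` is `1`. -/
noncomputable def normalized (κ : QuadraticForm F V) (S R : ℙ F V) : V :=
  (polar κ S.rep R.rep)⁻¹ • R.rep

theorem polar_normalized {S R : ℙ F V} (hSR : polar κ S.rep R.rep ≠ 0) :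
    polar κ S.rep (normalized κ S R) = 1 := by
  rw [normalized, polar_smul_right, smul_eq_mul, inv_mul_cancel₀ hSR]

theorem eq_of_normalized_eq {S R R' : ℙ F V} (hSR : polar κ S.rep R.rep ≠ 0)
    (hRR' : normalized κ S R = normalized κ S R') : R = R' := by
  refine (eq_of_rep_eq_smul (a := polar κ S.rep R.rep * (polar κ S.rep R'.rep)⁻¹) ?_).symm
  rw [mul_smul]
  change _ = _ • normalized κ S R'
  rw [← hRR', normalized, smul_smul, mul_inv_cancel₀ hSR, one_smul]

open scoped Classical in
theorem polar_normalized_sq (h : IsElliptic κ q) [Fintype (Point κ)] {P R : Circle κ} (S : ℙ F V)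
    (hPR : #{x | Inc κ x P ∧ Inc κ x R} = 1) :
    polar κ P.1.rep (normalized κ S R.1) ^ 2 = 4 * κ P.1.rep * κ (normalized κ S R.1) := by
  rw [normalized, polar_smul_right, QuadraticMap.map_smul, smul_eq_mul, smul_eq_mul, mul_pow,
    h.polar_sq_of_tangent hPR]
  ring

theorem four_ne_zero (h : IsElliptic κ q) : (4 : F) ≠ 0 := by
  have : (4 : F) = 2 * 2 := by norm_num
  rw [this]
  exact mul_ne_zero h.two_ne_zero h.two_ne_zero

open scoped Classical in
theorem card_common_tangents_of_secant (h : IsElliptic κ q) [Fintype (Point κ)]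
    [Fintype (Circle κ)] {S X : Point κ} {P Q : Circle κ} (hPQ : P ≠ Q) (hSX : X ≠ S)
    (hSP : Inc κ S P) (hSQ : Inc κ S Q) (hXP : Inc κ X P) (hXQ : Inc κ X Q) :
    #{R | #{x | Inc κ x P ∧ Inc κ x R} = 1 ∧ #{x | Inc κ x Q ∧ Inc κ x R} = 1} ≤ 2 * (q - 1) := by
  have := h.finite_field
  have := Fintype.ofFinite F
  have hsx := h.polar_ne_zero hSX
  have hli : LinearIndependent F ![S.1.rep, P.1.rep, Q.1.rep] := by
    rw [Fintype.linearIndependent_iff]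
    intro g hg
    simp only [Fin.sum_univ_three, Matrix.cons_val_zero, Matrix.cons_val_one,
      Matrix.cons_val] at hg
    have e0 : g 0 = 0 := by
      have := congrArg (polar κ X.1.rep) hg
      rw [polar_add_right, polar_add_right, polar_smul_right, polar_smul_right, polar_smul_right,
        hXP, hXQ, polar_zero_right] at this
      simpa [hsx] using this
    rw [e0, zero_smul, zero_add] at hg
    have e2 : g 2 = 0 := by
      by_contra h2
      refine hPQ (Subtype.ext (eq_of_rep_eq_smul (a := -((g 2)⁻¹ * g 1)) ?_))
      have := congrArg ((g 2)⁻¹ • ·) hg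
      simp only [smul_add, smul_smul, inv_mul_cancel₀ h2, one_smul, smul_zero] at this
      rw [neg_smul]
      exact eq_neg_of_add_eq_zero_right this
    rw [e2, zero_smul, add_zero] at hg
    have e1 : g 1 = 0 := (smul_eq_zero.1 hg).resolve_right P.1.rep_nonzero
    intro i
    fin_cases i
    · exact e0
    · exact e1
    · exact e2
  have hns : ∀ R : Circle κ, #{x | Inc κ x P ∧ Inc κ x R} = 1 →
      #{x | Inc κ x Q ∧ Inc κ x R} = 1 → polar κ S.1.rep R.1.rep ≠ 0 := by
    intro R hP hQ hSR
    obtain ⟨S', a, b, -, -, hu, hR⟩ := h.exists_of_card_eq_one hP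
    obtain ⟨S'', a', b', hQ', -, hu', hR'⟩ := h.exists_of_card_eq_one hQ
    obtain rfl := hu S hSP hSR
    obtain rfl := hu' S hSQ hSR
    have ha' := ne_zero_of_tangent hQ' hR'
    have hg := Fintype.linearIndependent_iff.1 hli ![b - b', a, -a'] (by
      simp only [Fin.sum_univ_three, Matrix.cons_val_zero, Matrix.cons_val_one, Matrix.cons_val]
      rw [sub_smul, neg_smul]
      have := sub_eq_zero.2 (hR.symm.trans hR')
      rw [← this]
      abel) 2
    simp [ha'] at hg
  rcases Finset.eq_empty_or_nonempty {R : Circle κ | #{x | Inc κ x P ∧ Inc κ x R} = 1 ∧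
    #{x | Inc κ x Q ∧ Inc κ x R} = 1} with hem | ⟨R₀, hR₀⟩
  · rw [hem, Finset.card_empty]
    exact Nat.zero_le _
  have hnz : ∀ R : Circle κ, #{x | Inc κ x P ∧ Inc κ x R} = 1 →
      #{x | Inc κ x Q ∧ Inc κ x R} = 1 → polar κ P.1.rep (normalized κ S.1 R.1) ≠ 0 := by
    intro R hP hQ h0
    have h1 := h.polar_normalized_sq S.1 hP
    rw [h0, normalized, QuadraticMap.map_smul, smul_eq_mul] at h1
    have := hns R hP hQ
    have := h.four_ne_zero
    have := P.2.1
    have := R.2.1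
    simp_all
  simp only [Finset.mem_filter, Finset.mem_univ, true_and] at hR₀
  set ρ : F := polar κ Q.1.rep (normalized κ S.1 R₀.1) / polar κ P.1.rep (normalized κ S.1 R₀.1)
    with hρ
  have hQρ : κ Q.1.rep = ρ ^ 2 * κ P.1.rep := by
    have h0 := hnz R₀ hR₀.1 hR₀.2
    have h1 := h.polar_normalized_sq S.1 hR₀.1
    have h2 := h.polar_normalized_sq S.1 hR₀.2
    have h3 : κ (normalized κ S.1 R₀.1) ≠ 0 := by
      intro h3
      rw [h3, mul_zero] at h1
      exact h0 (pow_eq_zero_iff (by norm_num) |>.1 h1)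
    rw [hρ, div_pow, h1, h2]
    have := h.four_ne_zero
    have := P.2.1
    field_simp
  have hpm : ∀ R : Circle κ, #{x | Inc κ x P ∧ Inc κ x R} = 1 →
      #{x | Inc κ x Q ∧ Inc κ x R} = 1 →
      polar κ Q.1.rep (normalized κ S.1 R.1) = ρ * polar κ P.1.rep (normalized κ S.1 R.1) ∨
      polar κ Q.1.rep (normalized κ S.1 R.1) = -(ρ * polar κ P.1.rep (normalized κ S.1 R.1)) := by
    intro R hP hQ
    refine sq_eq_sq_iff_eq_or_eq_neg.1 ?_
    rw [h.polar_normalized_sq S.1 hQ, mul_pow, h.polar_normalized_sq S.1 hP, hQρ]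
    ring
  have hcard : #(((univ : Finset F).erase 0) ×ˢ (univ : Finset Bool)) = 2 * (q - 1) := by
    rw [Finset.card_product, Finset.card_erase_of_mem (Finset.mem_univ _), Finset.card_univ,
      ← Nat.card_eq_fintype_card, h.card_field, mul_comm]
    rfl
  rw [← hcard]
  refine Finset.card_le_card_of_injOn (fun R => (polar κ P.1.rep (normalized κ S.1 R.1),
    decide (polar κ Q.1.rep (normalized κ S.1 R.1) =
      ρ * polar κ P.1.rep (normalized κ S.1 R.1)))) ?_ ?_
  · intro R hR
    simp only [Finset.coe_filter, Finset.mem_univ, true_and, Set.mem_ofPred_eq] at hR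
    simpa [em] using hnz R hR.1 hR.2
  · intro R hR R' hR' hRR'
    simp only [Finset.coe_filter, Finset.mem_univ, true_and, Set.mem_ofPred_eq] at hR hR'
    simp only [Prod.mk.injEq, decide_eq_decide] at hRR'
    obtain ⟨h1, h2⟩ := hRR'
    have h3 : polar κ Q.1.rep (normalized κ S.1 R.1) = polar κ Q.1.rep (normalized κ S.1 R'.1) := by
      rw [h1] at h2
      rcases hpm R hR.1 hR.2 with e | e <;> rcases hpm R' hR'.1 hR'.2 with e' | e'
      · rw [e, e', h1]
      · rw [e, h1] at h2 ⊢
        exact (h2.1 rfl).symm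
      · rw [h2.2 e', e']
      · rw [e, e', h1]
    have h4 : κ (normalized κ S.1 R.1) = κ (normalized κ S.1 R'.1) := by
      have h5 := h.polar_normalized_sq S.1 hR.1
      rw [h1, h.polar_normalized_sq S.1 hR'.1] at h5
      exact (mul_left_cancel₀ (mul_ne_zero h.four_ne_zero P.2.1) h5).symm
    exact Subtype.ext (eq_of_normalized_eq (hns R hR.1 hR.2) (h.eq_of_polar_eq S.2 hSP hSQ hli
      (polar_normalized (hns R hR.1 hR.2)) (polar_normalized (hns R' hR'.1 hR'.2)) h1 h3 h4))

theorem exists_linearIndependent_triple (h : IsElliptic κ q) {s p : V} (hs0 : s ≠ 0)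
    (hs : κ s = 0) (hp : κ p ≠ 0) (hsp : polar κ s p = 0) :
    ∃ y, polar κ s y = 0 ∧ LinearIndependent F ![s, p, y] := by
  have := h.finite_field
  have := h.finiteDimensional
  have := h.finite
  have hpp : polar κ p p ≠ 0 := by
    rw [polar_self, nsmul_eq_mul]
    exact mul_ne_zero (by exact_mod_cast h.two_ne_zero) hp
  obtain ⟨w, hw⟩ := h.exists_polar_eq_one hs0
  obtain ⟨v, hv, hpv⟩ : ∃ v, polar κ s v = 1 ∧ polar κ p v = 0 := by
    refine ⟨w - (polar κ p w / polar κ p p) • p, ?_, ?_⟩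
    · rw [polar_sub_right, polar_smul_right, hsp, hw, smul_zero, sub_zero]
    · rw [polar_sub_right, polar_smul_right, smul_eq_mul, div_mul_cancel₀ _ hpp, sub_self]
  have hli : LinearIndependent F ![s, v, p] := by
    rw [Fintype.linearIndependent_iff]
    intro g hg
    simp only [Fin.sum_univ_three, Matrix.cons_val_zero, Matrix.cons_val_one,
      Matrix.cons_val] at hg
    have e : ∀ z, g 0 * polar κ z s + g 1 * polar κ z v + g 2 * polar κ z p = 0 := fun z => by
      have := congrArg (polar κ z) hg
      simpa only [polar_add_right, polar_smul_right, polar_zero_right, smul_eq_mul] using this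
    have e1 : g 1 = 0 := by
      have := e s
      rw [polar_self_of_isotropic hs, hsp, hv] at this
      simpa using this
    have e2 : g 2 = 0 := by
      have := e p
      rw [polar_comm κ p s, hsp, hpv] at this
      simpa only [mul_zero, zero_add, add_zero, mul_eq_zero, hpp, or_false] using this
    have e0 : g 0 = 0 := by
      have := e v
      rw [polar_comm κ v s, hv, e1, e2] at this
      simpa using this
    intro i
    fin_cases i
    · exact e0
    · exact e1
    · exact e2
  have h1 := ncard_polar_eq_zero h.nondegenerate hli
  rw [h.card_field, h.finrank_eq, pow_one] at h1
  obtain ⟨y, hy, hy0⟩ := Set.exists_ne_of_one_lt_ncard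
    (h1.symm ▸ (by have := h.three_le; omega : 1 < q)) (0 : V)
  have hys : polar κ s y = 0 := hy 0
  have hyv : polar κ v y = 0 := hy 1
  have hyp : polar κ p y = 0 := hy 2
  refine ⟨y, hys, ?_⟩
  rw [Fintype.linearIndependent_iff]
  intro g hg
  simp only [Fin.sum_univ_three, Matrix.cons_val_zero, Matrix.cons_val_one,
    Matrix.cons_val] at hg
  have e : ∀ z, g 0 * polar κ z s + g 1 * polar κ z p + g 2 * polar κ z y = 0 := fun z => by
    have := congrArg (polar κ z) hg
    simpa only [polar_add_right, polar_smul_right, polar_zero_right, smul_eq_mul] using this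
  have e0 : g 0 = 0 := by
    have := e v
    rw [polar_comm κ v s, polar_comm κ v p, hv, hpv, hyv] at this
    simpa using this
  have e1 : g 1 = 0 := by
    have := e p
    rw [polar_comm κ p s, hsp, hyp] at this
    simpa only [mul_zero, zero_add, add_zero, mul_eq_zero, hpp, or_false] using this
  rw [e0, e1, zero_smul, zero_smul, zero_add, zero_add] at hg
  have e2 : g 2 = 0 := (smul_eq_zero.1 hg).resolve_right hy0
  intro i
  fin_cases i
  · exact e0
  · exact e1
  · exact e2

open scoped Classical in
theorem card_block (h : IsElliptic κ q) [Fintype (Point κ)] [Fintype (Circle κ)] (P : Circle κ) :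
    #{x | Inc κ x P} = q + 1 := by
  have h1 := h.isMoebiusPlane.sum_incidence_point P
  simp only [incidence, Finset.sum_boole] at h1
  exact_mod_cast h1

open scoped Classical in
theorem ne_of_tangent (h : IsElliptic κ q) [Fintype (Point κ)] {P R : Circle κ}
    (hPR : #{x | Inc κ x P ∧ Inc κ x R} = 1) : P ≠ R := by
  have := h.finite_field
  have := h.finite
  have := Fintype.ofFinite (Circle κ)
  rintro rfl
  simp only [and_self, h.card_block P] at hPR
  have := h.three_le
  omega

open scoped Classical in
theorem card_common_tangents_of_tangent (h : IsElliptic κ q) [Fintype (Point κ)]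
    [Fintype (Circle κ)] {S : Point κ} {P Q : Circle κ} (hPQ : P ≠ Q)
    (hSP : Inc κ S P) (hSQ : Inc κ S Q) (hu : ∀ X, Inc κ X P → Inc κ X Q → X = S) :
    #{R | #{x | Inc κ x P ∧ Inc κ x R} = 1 ∧ #{x | Inc κ x Q ∧ Inc κ x R} = 1} ≤ 2 * (q - 1) := by
  have := h.finite_field
  have := Fintype.ofFinite F
  obtain ⟨c, d, hQ⟩ := h.exists_rep_eq_of_tangent hSP hSQ hu
  have hc := ne_zero_of_tangent hSP hQ
  have hd : d ≠ 0 := by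
    rintro rfl
    rw [zero_smul, add_zero] at hQ
    exact hPQ (Subtype.ext (eq_of_rep_eq_smul hQ))
  have hκQ := map_rep_of_tangent hSP hQ
  have hcardF : Fintype.card F = q := by rw [← Nat.card_eq_fintype_card, h.card_field]
  have hq := h.three_le
  set A : Finset (Circle κ) :=
    {R | #{x | Inc κ x P ∧ Inc κ x R} = 1 ∧ #{x | Inc κ x Q ∧ Inc κ x R} = 1} with hA
  have hmem : ∀ {R}, R ∈ A → #{x | Inc κ x P ∧ Inc κ x R} = 1 ∧
      #{x | Inc κ x Q ∧ Inc κ x R} = 1 := fun hR => (Finset.mem_filter.1 hR).2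
  have h1 : #{R ∈ A | Inc κ S R} ≤ q - 2 := by
    have hT : #(((univ : Finset F).erase 0).erase (d / c)) = q - 2 := by
      rw [Finset.card_erase_of_mem, Finset.card_erase_of_mem (Finset.mem_univ _), Finset.card_univ,
        hcardF, Nat.sub_sub]
      exact Finset.mem_erase.2 ⟨div_ne_zero hd hc, Finset.mem_univ _⟩
    rw [← hT]
    refine Finset.card_le_card_of_forall_subsingleton
      (fun R l => ∃ a : F, R.1.rep = a • (P.1.rep + l • S.1.rep)) ?_ ?_
    · intro R hR
      obtain ⟨hRA, hSR⟩ := Finset.mem_filter.1 hR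
      obtain ⟨hP', hQ'⟩ := hmem hRA
      obtain ⟨S', a, b, -, -, hu', hab⟩ := h.exists_of_card_eq_one hP'
      obtain rfl := hu' S hSP hSR
      have ha := ne_zero_of_tangent hSP hab
      refine ⟨b / a, ?_, a, ?_⟩
      · refine Finset.mem_erase.2 ⟨fun hl => ?_, Finset.mem_erase.2 ⟨fun hl => ?_,
          Finset.mem_univ _⟩⟩
        · refine h.ne_of_tangent hQ' (Subtype.ext (eq_of_rep_eq_smul (a := a / c) ?_))
          rw [hab, hQ, smul_add, smul_smul, smul_smul, div_mul_cancel₀ _ hc, div_mul_eq_mul_div,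
            mul_div_assoc, ← hl, mul_div_cancel₀ _ ha]
        · rw [div_eq_zero_iff, or_iff_left ha] at hl
          rw [hl, zero_smul, add_zero] at hab
          exact h.ne_of_tangent hP' (Subtype.ext (eq_of_rep_eq_smul hab))
      · rw [hab, smul_add, smul_smul, mul_div_cancel₀ _ ha]
    · rintro l - R ⟨-, a, ha⟩ R' ⟨-, a', ha'⟩
      have ha0 : a ≠ 0 := by
        rintro rfl
        rw [zero_smul] at ha
        exact R.1.rep_nonzero ha
      refine Subtype.ext (eq_of_rep_eq_smul (a := a' * a⁻¹) ?_)
      rw [ha, ha', smul_smul, mul_assoc, inv_mul_cancel₀ ha0, mul_one]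
  have h2 : #{R ∈ A | ¬ Inc κ S R} ≤ q := by
    obtain ⟨y, hy, hli⟩ := h.exists_linearIndependent_triple S.1.rep_nonzero S.2 P.2.1 hSP
    have hpol : ∀ R ∈ A, ¬ Inc κ S R →
        polar κ P.1.rep (normalized κ S.1 R.1) = -(d / (2 * c)) := by
      intro R hR hSR
      obtain ⟨hP', hQ'⟩ := hmem hR
      have e1 := h.polar_normalized_sq S.1 hP'
      have e2 := h.polar_normalized_sq S.1 hQ'
      have e3 : polar κ Q.1.rep (normalized κ S.1 R.1) =
          c * polar κ P.1.rep (normalized κ S.1 R.1) + d := by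
        rw [hQ, polar_add_left, polar_smul_left, polar_smul_left, polar_normalized hSR]
        simp
      rw [e3, hκQ] at e2
      have e4 : d * (2 * c * polar κ P.1.rep (normalized κ S.1 R.1) + d) = 0 := by
        linear_combination e2 - c ^ 2 * e1
      have e5 := (mul_eq_zero.1 e4).resolve_left hd
      have := h.two_ne_zero
      field_simp
      linear_combination e5
    have hκ : ∀ R ∈ A, ¬ Inc κ S R → 4 * κ P.1.rep * κ (normalized κ S.1 R.1) =
        (-(d / (2 * c))) ^ 2 := by
      intro R hR hSR
      rw [← hpol R hR hSR, h.polar_normalized_sq S.1 (hmem hR).1]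
    calc #{R ∈ A | ¬ Inc κ S R} ≤ #(univ : Finset F) := by
          refine Finset.card_le_card_of_injOn (fun R => polar κ y (normalized κ S.1 R.1))
            (fun _ _ => Finset.mem_coe.2 (Finset.mem_univ _)) ?_
          intro R hR R' hR' hRR'
          obtain ⟨hR, hSR⟩ := Finset.mem_filter.1 (Finset.mem_coe.1 hR)
          obtain ⟨hR', hSR'⟩ := Finset.mem_filter.1 (Finset.mem_coe.1 hR')
          refine Subtype.ext (eq_of_normalized_eq hSR (h.eq_of_polar_eq S.2 hSP hy hli
            (polar_normalized hSR) (polar_normalized hSR') ?_ hRR' ?_))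
          · rw [hpol R hR hSR, hpol R' hR' hSR']
          · exact mul_left_cancel₀ (mul_ne_zero h.four_ne_zero P.2.1)
              ((hκ R hR hSR).trans (hκ R' hR' hSR').symm)
      _ = q := by rw [Finset.card_univ, hcardF]
  have h3 := Finset.card_filter_add_card_filter_not (s := A) (fun R => Inc κ S R)
  omega

open scoped Classical in
theorem card_common_tangents (h : IsElliptic κ q) [Fintype (Point κ)]
    [Fintype (Circle κ)] (S : Point κ) (P Q : Circle κ) (hPQ : P ≠ Q)
    (hSP : Inc κ S P) (hSQ : Inc κ S Q) :
    #{R | #{x | Inc κ x P ∧ Inc κ x R} = 1 ∧ #{x | Inc κ x Q ∧ Inc κ x R} = 1} ≤ 2 * (q - 1) := by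
  by_cases hX : ∃ X, X ≠ S ∧ Inc κ X P ∧ Inc κ X Q
  · obtain ⟨X, hXS, hXP, hXQ⟩ := hX
    exact h.card_common_tangents_of_secant hPQ hXS hSP hSQ hXP hXQ
  · push Not at hX
    exact h.card_common_tangents_of_tangent hPQ hSP hSQ fun X h1 h2 =>
      by_contra fun h3 => hX X h3 h1 h2

theorem ringChar_ne_two (h : IsElliptic κ q) : ringChar F ≠ 2 := by
  intro h2
  have := ringChar.of_eq h2
  exact h.two_ne_zero (CharTwo.two_eq_zero)

/-- The vectors of norm `c ≠ 0` in the plane orthogonal to a hyperbolic pair `s`, `x` number at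
most `q + 1`: translating by `s - c • x` embeds them in the circle of `s + c • x`. -/
theorem ncard_norm_eq_le (h : IsElliptic κ q) {s x : V} (hs : κ s = 0) (hx : κ x = 0)
    (hsx : polar κ s x = 1) {c : F} (hc : c ≠ 0) :
    {w | polar κ s w = 0 ∧ polar κ x w = 0 ∧ κ w = c}.ncard ≤ q + 1 := by
  classical
  have := h.finite_field
  have := h.finite
  have := Fintype.ofFinite (Circle κ)
  have := Fintype.ofFinite (Point κ)
  have hκp : κ (s + c • x) = c := by
    have h1 := map_add_smul κ s x 1 c
    rw [one_smul, hs, hx, hsx] at h1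
    rw [h1]; ring
  have hp0 : s + c • x ≠ 0 := by
    intro h0
    rw [h0, QuadraticMap.map_zero] at hκp
    exact hc hκp.symm
  set W := {w | polar κ s w = 0 ∧ polar κ x w = 0 ∧ κ w = c} with hW
  have hxs : polar κ x s = 1 := by rw [polar_comm, hsx]
  have hxw : ∀ w ∈ W, polar κ x (w + (s - c • x)) = 1 := by
    rintro w ⟨-, h2, -⟩
    rw [polar_add_right, polar_sub_right, polar_smul_right, polar_self_of_isotropic hx, h2, hxs]
    simp
  have hy0 : ∀ w ∈ W, w + (s - c • x) ≠ 0 := by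
    intro w hw h0
    have := hxw w hw
    rw [h0, polar_zero_right] at this
    exact zero_ne_one this
  have hsub : κ (s - c • x) = -c := by
    have h1 := map_add_smul κ s x 1 (-c)
    rw [one_smul, neg_smul, ← sub_eq_add_neg, hs, hx, hsx] at h1
    rw [h1]; ring
  have hy : ∀ w ∈ W, κ (w + (s - c • x)) = 0 := by
    rintro w ⟨h1, h2, h3⟩
    rw [QuadraticMap.map_add κ, h3, hsub, polar_sub_right, polar_smul_right, polar_comm κ w s,
      polar_comm κ w x, h1, h2]
    simp
  have hpy : ∀ w ∈ W, polar κ (w + (s - c • x)) (s + c • x) = 0 := by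
    rintro w ⟨h1, h2, h3⟩
    rw [polar_add_left, polar_add_right, polar_comm κ w s, h1, polar_smul_right, polar_comm κ w x,
      h2, polar_sub_left, polar_smul_left, polar_add_right, polar_add_right, polar_smul_right,
      polar_smul_right, polar_self_of_isotropic hs, polar_self_of_isotropic hx, hsx, hxs]
    simp
  have hex : ∀ w ∈ W, ∃ X : Point κ, ∃ a : Fˣ, a • (w + (s - c • x)) = X.1.rep := fun w hw =>
    ⟨⟨Projectivization.mk F _ (hy0 w hw), (map_mk_rep_eq_zero_iff κ (hy0 w hw)).2 (hy w hw)⟩,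
      Projectivization.exists_smul_eq_mk_rep F _ (hy0 w hw)⟩
  rcases W.eq_empty_or_nonempty with hem | ⟨w₀, hw₀⟩
  · rw [hem, Set.ncard_empty]
    exact Nat.zero_le _
  have : Nonempty (Point κ) := ⟨(hex w₀ hw₀).choose⟩
  choose! Y a ha using hex
  let P : Circle κ := ⟨Projectivization.mk F _ hp0,
    fun h0 => hc (hκp ▸ (map_mk_rep_eq_zero_iff κ hp0).1 h0), (Y w₀).1, (Y w₀).2, by
      rw [polar_mk_rep_eq_zero_iff, ← ha w₀ hw₀, Units.smul_def, polar_smul_left, hpy w₀ hw₀,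
        smul_zero]⟩
  have hP : ∀ w ∈ W, Y w ∈ ({X | Inc κ X P} : Finset (Point κ)) := by
    intro w hw
    refine Finset.mem_filter.2 ⟨Finset.mem_univ _, ?_⟩
    rw [Inc, polar_mk_rep_eq_zero_iff, ← ha w hw, Units.smul_def, polar_smul_left, hpy w hw,
      smul_zero]
  rw [← h.card_block P, ← Set.ncard_coe_finset]
  refine Set.ncard_le_ncard_of_injOn Y hP ?_
  intro w hw w' hw' hww'
  have h1 : (a w : F) • (w + (s - c • x)) = (a w' : F) • (w' + (s - c • x)) := by
    have := ha w hw
    rw [hww', ← ha w' hw'] at this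
    exact this
  have h2 := congrArg (polar κ x) h1
  rw [polar_smul_right, polar_smul_right, hxw w hw, hxw w' hw', smul_eq_mul, smul_eq_mul, mul_one,
    mul_one] at h2
  rw [h2] at h1
  exact add_right_cancel (smul_right_injective V (a w').ne_zero h1)

open scoped Classical in
theorem two_mul_card_class_le (h : IsElliptic κ q) [Fintype (Point κ)] [Fintype (Circle κ)]
    {S X : Point κ} (hSX : S ≠ X) (σ : Prop) :
    2 * #{P | Inc κ S P ∧ Inc κ X P ∧ (σ ↔ IsSquare (κ P.1.rep))} ≤ q + 1 := by
  have := h.finite_field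
  have := h.finite
  have hsx := h.polar_ne_zero hSX
  set x : V := (polar κ S.1.rep X.1.rep)⁻¹ • X.1.rep with hx
  have hsx1 : polar κ S.1.rep x = 1 := polar_normalized hsx
  have hκx : κ x = 0 := by rw [hx, QuadraticMap.map_smul, X.2, smul_zero]
  have hxv : ∀ v, polar κ x v = 0 ↔ polar κ X.1.rep v = 0 := fun v => by
    rw [hx, polar_smul_left, smul_eq_mul, mul_eq_zero, or_iff_right (inv_ne_zero hsx)]
  set p : V → Prop := fun v => polar κ S.1.rep v = 0 ∧ polar κ x v = 0 ∧ κ v ≠ 0 ∧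
    (σ ↔ IsSquare (κ v)) with hp
  have h1 : #{P : Circle κ | Inc κ S P ∧ Inc κ X P ∧ (σ ↔ IsSquare (κ P.1.rep))} ≤
      {P : ℙ F V | p P.rep}.ncard := by
    rw [← Set.ncard_coe_finset, ← Set.ncard_image_of_injective _ Subtype.val_injective]
    refine Set.ncard_le_ncard ?_ (Set.toFinite _)
    rintro _ ⟨P, hP, rfl⟩
    obtain ⟨-, h2, h3, h4⟩ := Finset.mem_filter.1 hP
    exact ⟨h2, (hxv _).2 h3, P.2.1, h4⟩
  have := Fintype.ofFinite F
  have h2 := ncard_projectivization (F := F) (p := p) (by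
    rintro a v ⟨e1, e2, e3, e4⟩
    refine ⟨?_, ?_, ?_, ?_⟩
    · rw [Units.smul_def, polar_smul_right, e1, smul_zero]
    · rw [Units.smul_def, polar_smul_right, e2, smul_zero]
    · rw [Units.smul_def, QuadraticMap.map_smul, smul_eq_mul]
      exact mul_ne_zero (mul_ne_zero a.ne_zero a.ne_zero) e3
    · rw [e4, Units.smul_def, QuadraticMap.map_smul, smul_eq_mul]
      refine ⟨fun e => (IsSquare.mul_self _).mul e, fun e => ?_⟩
      have e5 := (IsSquare.mul_self (a : F)⁻¹).mul e
      have e6 : (a : F)⁻¹ * (a : F)⁻¹ * (a * a * κ v) = κ v := by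
        have := a.ne_zero
        field_simp
      rwa [e6] at e5)
  have h3 : {v : V | v ≠ 0 ∧ p v} ⊆ ⋃ c ∈ ({c : F | c ≠ 0 ∧ (σ ↔ IsSquare c)} : Finset F),
      {w | polar κ S.1.rep w = 0 ∧ polar κ x w = 0 ∧ κ w = c} := by
    rintro v ⟨-, e1, e2, e3, e4⟩
    simp only [Set.mem_iUnion]
    exact ⟨κ v, Finset.mem_filter.2 ⟨Finset.mem_univ _, e3, e4⟩, e1, e2, rfl⟩
  have h4 := (Set.ncard_le_ncard h3 (Set.toFinite _)).trans
    (Finset.set_ncard_biUnion_le _ _)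
  have h5 := h4.trans (Finset.sum_le_card_nsmul _ _ (q + 1) fun c hc =>
    h.ncard_norm_eq_le S.2 hκx hsx1 (Finset.mem_filter.1 hc).2.1)
  have h6 := two_mul_card_class h.ringChar_ne_two σ
  rw [← Nat.card_eq_fintype_card, h.card_field] at h6
  rw [← h2, h.card_field, smul_eq_mul] at h5
  have hq := h.three_le
  refine Nat.le_of_mul_le_mul_right (c := q - 1) ?_ (by omega)
  have h7 : 2 * #{c : F | c ≠ 0 ∧ (σ ↔ IsSquare c)} = q - 1 := by omega
  calc _ ≤ 2 * {P : ℙ F V | p P.rep}.ncard * (q - 1) := by gcongr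
    _ = 2 * ({P : ℙ F V | p P.rep}.ncard * (q - 1)) := by ring
    _ ≤ 2 * (#{c : F | c ≠ 0 ∧ (σ ↔ IsSquare c)} * (q + 1)) := by gcongr
    _ = (q + 1) * (2 * #{c : F | c ≠ 0 ∧ (σ ↔ IsSquare c)}) := by ring
    _ = (q + 1) * (q - 1) := by rw [h7]

theorem isClassedMoebiusPlane (h : IsElliptic κ q) [Fintype (Point κ)] [Fintype (Circle κ)] :
    IsClassedMoebiusPlane (Inc κ) q (fun P => IsSquare (κ P.1.rep)) where
  toIsMoebiusPlane := h.isMoebiusPlane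
  class_eq _ _ := h.isSquare_iff_of_tangent
  class_two _ _ hSX P := h.two_mul_card_class_le hSX (IsSquare (κ P.1.rep))
  common_tangents := h.card_common_tangents

open scoped Classical in
/-- A circle `P` and an isotropic point `S` off `P` determine the second isotropic point on the
line of `S` and `P`; in an intersecting family, the two isotropic points determine `P`. -/
theorem card_intersecting_mul_le (h : IsElliptic κ q) [Fintype (Point κ)] [Fintype (Circle κ)]
    (𝒻 : Finset (Circle κ)) (hint : ∀ P ∈ 𝒻, ∀ R ∈ 𝒻, ∃ X, Inc κ X P ∧ Inc κ X R) :
    #𝒻 * (q ^ 2 - q) ≤ (q ^ 2 + 1) * q ^ 2 := by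
  have hpts := h.isMoebiusPlane.card_points
  have hoff : ∀ P : Circle κ, #{S | ¬ Inc κ S P} = q ^ 2 - q := by
    intro P
    have h1 := Finset.card_filter_add_card_filter_not (s := univ) (fun S => Inc κ S P)
    rw [h.card_block P, Finset.card_univ, hpts] at h1
    have : q ≤ q ^ 2 := Nat.le_self_pow (by norm_num) q
    omega
  have h1 : #(𝒻.sigma fun P => ({S | ¬ Inc κ S P} : Finset (Point κ))) = #𝒻 * (q ^ 2 - q) := by
    rw [Finset.card_sigma, Finset.sum_congr rfl fun P _ => hoff P, Finset.sum_const, smul_eq_mul]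
  have h2 : #(univ : Finset (Point κ)).offDiag = (q ^ 2 + 1) * q ^ 2 := by
    rw [Finset.offDiag_card, Finset.card_univ, hpts]
    have : (q ^ 2 + 1) * (q ^ 2 + 1) = (q ^ 2 + 1) * q ^ 2 + (q ^ 2 + 1) := by ring
    omega
  rw [← h1, ← h2]
  refine Finset.card_le_card_of_forall_subsingleton (fun z w => z.2 = w.1 ∧
    ∃ a b : F, z.1.1.rep = a • w.1.1.rep + b • w.2.1.rep) ?_ ?_
  · rintro ⟨P, S⟩ hPS
    obtain ⟨-, hSP⟩ := Finset.mem_sigma.1 hPS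
    replace hSP : polar κ S.1.rep P.1.rep ≠ 0 := (Finset.mem_filter.1 hSP).2
    have hP := P.2.1
    have hpol : polar κ S.1.rep (S.1.rep +
        (-(polar κ S.1.rep P.1.rep / κ P.1.rep)) • P.1.rep) ≠ 0 := by
      rw [polar_add_right, polar_smul_right, polar_self_of_isotropic S.2, zero_add, smul_eq_mul]
      exact mul_ne_zero (neg_ne_zero.2 (div_ne_zero hSP hP)) hSP
    have hx : κ (S.1.rep + (-(polar κ S.1.rep P.1.rep / κ P.1.rep)) • P.1.rep) = 0 := by
      have h3 := map_add_smul κ S.1.rep P.1.rep 1 (-(polar κ S.1.rep P.1.rep / κ P.1.rep))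
      rw [one_smul, S.2] at h3
      rw [h3]
      field_simp
      ring
    have hx0 : S.1.rep + (-(polar κ S.1.rep P.1.rep / κ P.1.rep)) • P.1.rep ≠ 0 := by
      intro h0
      rw [h0, polar_zero_right] at hpol
      exact hpol rfl
    let X : Point κ := ⟨Projectivization.mk F _ hx0, (map_mk_rep_eq_zero_iff κ hx0).2 hx⟩
    have hSX : S ≠ X := by
      intro hSX
      refine hpol ((polar_mk_rep_eq_zero_iff κ S.1.rep hx0).1 ?_)
      change polar κ S.1.rep X.1.rep = 0
      rw [← hSX]
      exact polar_self_of_isotropic S.2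
    obtain ⟨t, ht⟩ := Projectivization.exists_smul_eq_mk_rep F _ hx0
    refine ⟨(S, X), Finset.mem_offDiag.2 ⟨Finset.mem_univ _, Finset.mem_univ _, hSX⟩, rfl,
      κ P.1.rep / polar κ S.1.rep P.1.rep,
      -(κ P.1.rep / polar κ S.1.rep P.1.rep * (t : F)⁻¹), ?_⟩
    change P.1.rep = _ • S.1.rep + _ • (Projectivization.mk F _ hx0).rep
    rw [← ht, Units.smul_def, smul_smul, neg_mul, mul_assoc, inv_mul_cancel₀ t.ne_zero, mul_one,
      smul_add, smul_smul, neg_mul_neg, neg_smul, ← add_assoc, add_neg_cancel, zero_add,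
      div_mul_div_comm, mul_comm, div_self (mul_ne_zero hSP hP), one_smul]
  · rintro ⟨S, X⟩ hSX ⟨P, S'⟩ ⟨hP, rfl, a, b, hab⟩ ⟨P', S''⟩ ⟨hP', hS'', a', b', hab'⟩
    obtain ⟨-, -, hSX⟩ := Finset.mem_offDiag.1 hSX
    obtain rfl : S'' = S' := hS''
    have hPF := (Finset.mem_sigma.1 hP).1
    have hPF' := (Finset.mem_sigma.1 hP').1
    obtain ⟨Y, hY, hY'⟩ := hint P hPF P' hPF'
    have hSP : polar κ S''.1.rep P.1.rep ≠ 0 :=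
      (Finset.mem_filter.1 (Finset.mem_sigma.1 hP).2).2
    dsimp only at hab hab'
    have hb : b ≠ 0 := by
      rintro rfl
      rw [hab, zero_smul, add_zero, polar_smul_right, polar_self_of_isotropic S''.2,
        smul_zero] at hSP
      exact hSP rfl
    rw [Inc, hab, polar_add_right, polar_smul_right, polar_smul_right, smul_eq_mul,
      smul_eq_mul] at hY
    rw [Inc, hab', polar_add_right, polar_smul_right, polar_smul_right, smul_eq_mul,
      smul_eq_mul] at hY'
    have hdet : a * b' = a' * b := by
      by_contra hdet
      have hdet' : a * b' - a' * b ≠ 0 := sub_ne_zero.2 hdet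
      have hYS : polar κ Y.1.rep S''.1.rep = 0 :=
        (mul_eq_zero.1 (by linear_combination b' * hY - b * hY' :
          (a * b' - a' * b) * polar κ Y.1.rep S''.1.rep = 0)).resolve_left hdet'
      have hYX : polar κ Y.1.rep X.1.rep = 0 :=
        (mul_eq_zero.1 (by linear_combination a * hY' - a' * hY :
          (a * b' - a' * b) * polar κ Y.1.rep X.1.rep = 0)).resolve_left hdet'
      exact hSX (Subtype.ext ((h.eq_of_polar_eq_zero Y.2 S''.2 hYS).symm.trans
        (h.eq_of_polar_eq_zero Y.2 X.2 hYX)))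
    obtain rfl : P = P' := Subtype.ext (eq_of_rep_eq_smul (a := b' / b) (by
      rw [hab, hab', smul_add, smul_smul, smul_smul, div_mul_cancel₀ _ hb, div_mul_eq_mul_div,
        mul_comm b' a, hdet, mul_div_cancel_right₀ _ hb]))
    rfl

theorem exists_common_point (h : IsElliptic κ q) [Fintype (Point κ)] [Fintype (Circle κ)]
    (𝒻 : Finset (Circle κ)) (hint : ∀ P ∈ 𝒻, ∀ R ∈ 𝒻, ∃ X, Inc κ X P ∧ Inc κ X R)
    (hsize : 707 / 1000 * (q : ℝ) ^ 2 + 2828 / 1000 * q + 8 ≤ #𝒻) :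
    ∃ S, ∀ P ∈ 𝒻, Inc κ S P := by
  rcases le_or_gt 9 q with hq | hq
  · exact h.isClassedMoebiusPlane.all_through_point 𝒻 hint hq hsize
  · exfalso
    have h1 := h.card_intersecting_mul_le 𝒻 hint
    have h3 := h.three_le
    have hodd := Nat.odd_iff.1 h.odd
    obtain rfl | rfl | rfl : q = 3 ∨ q = 5 ∨ q = 7 := by omega
    all_goals
      norm_num at h1 hsize
      have h2 : ((#𝒻 * _ : ℕ) : ℝ) ≤ _ := Nat.cast_le.2 h1
      push_cast at h2
      linarith

end IsElliptic

end MoebiusPlane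

/-- **Stability of intersecting families in elliptic-quadric Möbius planes of odd order.**
If an intersecting family `𝒻` of circles has size at least `q²/√2 + 2√2·q + 8`,
then all its circles pass through a common isotropic point. -/
theorem stmt_2 (q : ℕ) (hq : Odd q)
    (F : Type) [Field F] [Fintype F] (hF : Fintype.card F = q)
    (κ : QuadraticForm F (Fin 4 → F))
    (hnd : ∀ x : Fin 4 → F, (∀ y : Fin 4 → F, QuadraticMap.polar (⇑κ) x y = 0) → x = 0)
    (hell : {P : Projectivization F (Fin 4 → F) | κ P.rep = 0}.ncard = q ^ 2 + 1)
    (𝒻 : Set (Projectivization F (Fin 4 → F)))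
    (h𝒻 : ∀ P ∈ 𝒻, κ P.rep ≠ 0)
    (hint : ∀ P ∈ 𝒻, ∀ R ∈ 𝒻, ∃ S : Projectivization F (Fin 4 → F),
      κ S.rep = 0 ∧ QuadraticMap.polar (⇑κ) S.rep P.rep = 0 ∧
        QuadraticMap.polar (⇑κ) S.rep R.rep = 0)
    (hsize : (1 / Real.sqrt 2) * (q : ℝ) ^ 2 + 2 * Real.sqrt 2 * (q : ℝ) + 8 ≤ (𝒻.ncard : ℝ)) :
    ∃ S : Projectivization F (Fin 4 → F), κ S.rep = 0 ∧
      ∀ P ∈ 𝒻, QuadraticMap.polar (⇑κ) S.rep P.rep = 0 := by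
  classical
  have h : IsElliptic κ q := ⟨hq, by rw [Nat.card_eq_fintype_card, hF], by simp, hnd, hell⟩
  have := Fintype.ofFinite (IsElliptic.Point κ)
  have := Fintype.ofFinite (IsElliptic.Circle κ)
  have hcircle : ∀ P ∈ 𝒻, κ P.rep ≠ 0 ∧ ∃ S : Projectivization F (Fin 4 → F), κ S.rep = 0 ∧
      QuadraticMap.polar κ S.rep P.rep = 0 := by
    intro P hP
    obtain ⟨S, h1, h2, -⟩ := hint P hP P hP
    exact ⟨h𝒻 P hP, S, h1, h2⟩
  have hcard : Finset.card {P : IsElliptic.Circle κ | P.1 ∈ 𝒻} = 𝒻.ncard := by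
    rw [IsElliptic.card_filter_subtype _ fun P => P ∈ 𝒻]
    congr 1
    ext P
    exact ⟨fun hP => hP.2, fun hP => ⟨hcircle P hP, hP⟩⟩
  have hsqrt1 : (1.414 : ℝ) ≤ Real.sqrt 2 := Real.le_sqrt_of_sq_le (by norm_num)
  have hsqrt2 : 1 / Real.sqrt 2 = Real.sqrt 2 / 2 := by
    rw [one_div, ← Real.sqrt_div_self]
  obtain ⟨S, hS⟩ := h.exists_common_point {P : IsElliptic.Circle κ | P.1 ∈ 𝒻} (by
      intro P hP R hR
      obtain ⟨S, h1, h2, h3⟩ := hint P.1 (Finset.mem_filter.1 hP).2 R.1 (Finset.mem_filter.1 hR).2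
      exact ⟨⟨S, h1⟩, h2, h3⟩) (by
    rw [hcard]
    refine le_trans ?_ hsize
    rw [hsqrt2]
    gcongr ?_ * _ + ?_ * _ + _ <;> linarith)
  exact ⟨S.1, S.2, fun P hP => hS ⟨P, hcircle P hP⟩ (Finset.mem_filter.2 ⟨Finset.mem_univ _, hP⟩)⟩
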